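/- arXiv:solv-int/9702008 — 2 statements merged into one kernel-verified Lean document; each statement's English description precedes it below -/
import Mathlib

section
/- For the Hirota–Satsuma system u_t = 6α·u·u_x − 6v·v_x + α·u_xxx, v_t = −3u·v_x − v_xxx, the quantity ρ = u·v is a conserved density (∂_t ρ a total x-derivative along solutions) if and only if α = −1. -/
/-- Partial derivative with respect to the first (space) variable. -/
noncomputable def pdx (u : ℝ × ℝ → ℝ) : ℝ × ℝ → ℝ :=
  fun p => deriv (fun x => u (x, p.2)) p.1

/-- Partial derivative with respect to the second (time) variable. -/
noncomputable def pdt (u : ℝ × ℝ → ℝ) : ℝ × ℝ → ℝ :=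
  fun p => deriv (fun t => u (p.1, t)) p.2

/-- Evaluation of a polynomial differential expression `J` in two dependent
variables and their `x`-derivatives up to order `N - 1`, along `(u, v)`. -/
noncomputable def evalJet2 (N : ℕ) (J : MvPolynomial (Fin N × Fin 2) ℝ)
    (u v : ℝ × ℝ → ℝ) (p : ℝ × ℝ) : ℝ :=
  MvPolynomial.eval
    (fun i : Fin N × Fin 2 =>
      iteratedDeriv (i.1 : ℕ) (fun y => (if i.2 = 0 then u else v) (y, p.2)) p.1) J



open Real in
theorem angle_exists (h : ℝ) : ∃ θ : ℝ → ℝ, ContDiff ℝ (⊤ : ℕ∞) θ ∧ Function.Surjective θ ∧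
    ∀ x, HasDerivAt θ (√(1 + h^2 * (1 + sin (θ x) ^ 2) / 2)) x := by
  set w : ℝ → ℝ := fun φ => √(1 + h^2 * (1 + sin φ ^ 2) / 2) with hw
  have hpos : ∀ φ, 0 < 1 + h^2 * (1 + sin φ ^ 2) / 2 := fun φ => by positivity
  have hwpos : ∀ φ, 0 < w φ := fun φ => Real.sqrt_pos.2 (hpos φ)
  have hwc : ContDiff ℝ (⊤ : ℕ∞) w := by
    apply ContDiff.sqrt
    · fun_prop
    · intro x; exact (hpos x).ne'
  have hwle : ∀ φ, w φ ≤ √(1 + h^2) := fun φ => by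
    apply Real.sqrt_le_sqrt
    nlinarith [sin_sq_le_one φ, sq_nonneg h]
  set X : ℝ → ℝ := fun φ => ∫ s in (0:ℝ)..φ, (w s)⁻¹ with hX
  have hic : Continuous fun s => (w s)⁻¹ := hwc.continuous.inv₀ (fun s => (hwpos s).ne')
  have hXd : ∀ φ, HasDerivAt X (w φ)⁻¹ φ := fun φ =>
    intervalIntegral.integral_hasDerivAt_right (hic.intervalIntegrable _ _)
      (hic.stronglyMeasurableAtFilter _ _) hic.continuousAt
  have hXc : Continuous X := continuous_iff_continuousAt.2 fun φ => (hXd φ).continuousAt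
  have hXm : StrictMono X := strictMono_of_deriv_pos fun φ => by
    rw [(hXd φ).deriv]; exact inv_pos.2 (hwpos φ)
  set k := (√(1 + h^2))⁻¹ with hk
  have hkpos : 0 < k := by positivity
  have hkle : ∀ φ, k ≤ (w φ)⁻¹ := fun φ => inv_anti₀ (hwpos φ) (hwle φ)
  have hmono : Monotone fun φ => X φ - k * φ := by
    apply monotone_of_deriv_nonneg
    · intro φ; exact ((hXd φ).sub ((hasDerivAt_id φ).const_mul k)).differentiableAt
    · intro φ
      have := ((hXd φ).sub ((hasDerivAt_id φ).const_mul k)).deriv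
      have h2 : deriv (fun φ => X φ - k * φ) φ = (w φ)⁻¹ - k * 1 := this
      rw [h2]; linarith [hkle φ]
  have hX0 : X 0 = 0 := by simp [hX]
  have hsurj : Function.Surjective X := by
    apply hXc.surjective
    · apply Filter.tendsto_atTop_mono' _ _ (Filter.tendsto_id.const_mul_atTop hkpos)
      filter_upwards [Filter.eventually_ge_atTop 0] with φ hφ
      have := hmono hφ
      simp [hX0] at this
      simpa using this
    · apply Filter.tendsto_atBot_mono' _ _ (Filter.tendsto_id.const_mul_atBot hkpos)
      filter_upwards [Filter.eventually_le_atBot 0] with φ hφ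
      have := hmono hφ
      simp [hX0] at this
      simpa using this
  let e := StrictMono.orderIsoOfSurjective X hXm hsurj
  have he : ∀ x, X (e.symm x) = x := fun x => e.apply_symm_apply x
  have hd : ∀ x, HasDerivAt e.symm (w (e.symm x)) x := fun x => by
    have := HasDerivAt.of_local_left_inverse (f := X) (g := e.symm) (a := x)
      (e.symm.continuous.continuousAt) (hXd _) (inv_pos.2 (hwpos _)).ne'
      (Filter.Eventually.of_forall he)
    simpa using this
  refine ⟨e.symm, ?_, e.symm.surjective, hd⟩
  have hder : deriv e.symm = fun x => w (e.symm x) := funext fun x => (hd x).deriv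
  have : ∀ n : ℕ, ContDiff ℝ n e.symm := by
    intro n
    induction n with
    | zero => simpa [contDiff_zero] using e.symm.continuous
    | succ n ih =>
      have : ((n + 1 : ℕ) : WithTop ℕ∞) = (n : WithTop ℕ∞) + 1 := by norm_cast
      rw [this, contDiff_succ_iff_deriv]
      refine ⟨fun x => (hd x).differentiableAt, by simp, ?_⟩
      rw [hder]
      exact (hwc.of_le (by exact_mod_cast le_top)).comp ih
  exact contDiff_infty.2 this

open Real in
theorem duffing_exists (h l : ℝ) (hl : 0 < l) : ∃ K L : ℝ → ℝ, ContDiff ℝ (⊤ : ℕ∞) K ∧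
    (∀ x, HasDerivAt K (L x) x) ∧ (∀ x, HasDerivAt L (-(l^2) * (K x + K x ^ 3)) x) ∧
    (∀ x, L x ^ 2 = l^2 * ((h^2 + h^4/2) - K x ^ 2 - K x ^ 4 / 2)) ∧
    (∃ x, K x = h) ∧ (∃ x, K x = -h) := by
  obtain ⟨θ, hc, hs, hd⟩ := angle_exists h
  have hpos : ∀ φ : ℝ, 0 < 1 + h^2 * (1 + sin φ ^ 2) / 2 := fun φ => by positivity
  have hdl : ∀ x, HasDerivAt (fun x => θ (l * x))
      (√(1 + h^2 * (1 + sin (θ (l * x)) ^ 2) / 2) * l) x := fun x => by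
    have := (hd (l * x)).comp x ((hasDerivAt_id x).const_mul l)
    simp only [mul_one] at this
    exact this
  refine ⟨fun x => h * sin (θ (l * x)),
    fun x => h * (cos (θ (l * x)) * (√(1 + h^2 * (1 + sin (θ (l * x)) ^ 2) / 2) * l)),
    ?_, fun x => ?_, fun x => ?_, fun x => ?_, ?_, ?_⟩
  · have : ContDiff ℝ (⊤ : ℕ∞) (fun x => θ (l * x)) := hc.comp (by fun_prop)
    fun_prop
  · exact ((hdl x).sin).const_mul h
  · have h1 := ((((((hdl x).sin.pow 2).const_add 1).const_mul (h^2)).div_const 2).const_add 1).sqrt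
      (hpos _).ne'
    have h2 := (((hdl x).cos.mul (h1.mul_const l))).const_mul h
    refine h2.congr_deriv ?_
    have hq := Real.sq_sqrt (hpos (θ (l*x))).le
    have hp := Real.sqrt_pos.2 (hpos (θ (l*x)))
    simp only [Pi.pow_apply]
    set r := √(1 + h^2 * (1 + sin (θ (l * x)) ^ 2) / 2) with hr
    have hsc := sin_sq_add_cos_sq (θ (l * x))
    set S := sin (θ (l * x))
    set C := cos (θ (l * x))
    field_simp
    norm_num
    linear_combination (-4 * S * h) * hq + (2 * S*h^3) * hsc
  · have hq := Real.sq_sqrt (hpos (θ (l*x))).le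
    have hsc := sin_sq_add_cos_sq (θ (l * x))
    simp only [mul_pow, hq]
    have hC : cos (θ (l * x)) ^2 = 1 - sin (θ (l * x)) ^2 := by linarith
    rw [hC]; ring
  · obtain ⟨y, hy⟩ := hs (π / 2)
    exact ⟨y / l, by simp only [mul_div_cancel₀ _ hl.ne']; rw [hy]; simp⟩
  · obtain ⟨y, hy⟩ := hs (-(π / 2))
    exact ⟨y / l, by simp only [mul_div_cancel₀ _ hl.ne']; rw [hy]; simp⟩
open Polynomial in
theorem jet_form (N : ℕ) (J : MvPolynomial (Fin N × Fin 2) ℝ) :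
    ∃ (c0 a1 a2 b1 b2 b3 b4 b5 d1 d2 d3 d4 d5 d6 d7 d8 d9 d10 : ℝ), ∀ Y : ℕ → Fin 2 → ℝ,
      (∀ n i, Odd n → Y n i = 0) →
      let P : ℝ[X] := MvPolynomial.aeval
        (fun i : Fin N × Fin 2 => C (Y i.1 i.2) * X ^ ((i.1 : ℕ) / 2 + 1)) J
      P.coeff 0 = c0 ∧ P.coeff 1 = a1 * Y 0 0 + a2 * Y 0 1 ∧
      P.coeff 2 = b1 * Y 0 0 ^ 2 + b2 * (Y 0 0 * Y 0 1) + b3 * Y 0 1 ^ 2 + b4 * Y 2 0 + b5 * Y 2 1 ∧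
      P.coeff 3 = d1 * Y 0 0 ^ 3 + d2 * (Y 0 0 ^ 2 * Y 0 1) + d3 * (Y 0 0 * Y 0 1 ^ 2)
        + d4 * Y 0 1 ^ 3 + d5 * (Y 0 0 * Y 2 0) + d6 * (Y 0 0 * Y 2 1) + d7 * (Y 0 1 * Y 2 0)
        + d8 * (Y 0 1 * Y 2 1) + d9 * Y 4 0 + d10 * Y 4 1 := by
  induction J using MvPolynomial.induction_on with
  | C a =>
    refine ⟨a, 0, 0, 0, 0, 0, 0, 0, 0, 0, 0, 0, 0, 0, 0, 0, 0, 0, fun Y hY => ?_⟩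
    simp [coeff_C, Polynomial.algebraMap_eq]
  | add p q hp hq =>
    obtain ⟨c0, a1, a2, b1, b2, b3, b4, b5, d1, d2, d3, d4, d5, d6, d7, d8, d9, d10, H⟩ := hp
    obtain ⟨c0', a1', a2', b1', b2', b3', b4', b5', d1', d2', d3', d4', d5', d6', d7', d8', d9', d10', H'⟩ := hq
    refine ⟨c0+c0', a1+a1', a2+a2', b1+b1', b2+b2', b3+b3', b4+b4', b5+b5', d1+d1', d2+d2',
      d3+d3', d4+d4', d5+d5', d6+d6', d7+d7', d8+d8', d9+d9', d10+d10', fun Y hY => ?_⟩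
    obtain ⟨h0, h1, h2, h3⟩ := H Y hY
    obtain ⟨h0', h1', h2', h3'⟩ := H' Y hY
    simp only [map_add, coeff_add, h0, h1, h2, h3, h0', h1', h2', h3']
    refine ⟨trivial, ?_, ?_, ?_⟩ <;> ring
  | mul_X p i hp =>
    obtain ⟨c0, a1, a2, b1, b2, b3, b4, b5, d1, d2, d3, d4, d5, d6, d7, d8, d9, d10, H⟩ := hp
    obtain ⟨⟨n, hn⟩, j⟩ := i
    have key : ∀ Y : ℕ → Fin 2 → ℝ, ∀ m, (MvPolynomial.aeval
        (fun i : Fin N × Fin 2 => (C (Y i.1 i.2) * X ^ ((i.1 : ℕ) / 2 + 1) : ℝ[X]))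
          (p * MvPolynomial.X (⟨n, hn⟩, j))).coeff m = if n / 2 + 1 ≤ m then
          Y n j * (MvPolynomial.aeval
        (fun i : Fin N × Fin 2 => (C (Y i.1 i.2) * X ^ ((i.1 : ℕ) / 2 + 1) : ℝ[X])) p).coeff
          (m - (n / 2 + 1)) else 0 := by
      intro Y m
      rw [map_mul, MvPolynomial.aeval_X, ← mul_assoc, coeff_mul_X_pow', coeff_mul_C]
      simp only [mul_comm]
    simp only [key]
    rcases Nat.even_or_odd' n with ⟨k, rfl | rfl⟩
    · rw [Nat.mul_div_cancel_left k (by norm_num)]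
      rcases k with _ | _ | _ | k
      · fin_cases j
        · refine ⟨0, c0, 0, a1, a2, 0, 0, 0, b1, b2, b3, 0, b4, b5, 0, 0, 0, 0, fun Y hY => ?_⟩
          obtain ⟨h0, h1, h2, h3⟩ := H Y hY
          simp [h0, h1, h2]
          refine ⟨?_, ?_, ?_⟩ <;> ring
        · refine ⟨0, 0, c0, 0, a1, a2, 0, 0, 0, b1, b2, b3, 0, 0, b4, b5, 0, 0, fun Y hY => ?_⟩
          obtain ⟨h0, h1, h2, h3⟩ := H Y hY
          simp [h0, h1, h2]
          refine ⟨?_, ?_, ?_⟩ <;> ring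
      · fin_cases j
        · refine ⟨0, 0, 0, 0, 0, 0, c0, 0, 0, 0, 0, 0, a1, 0, a2, 0, 0, 0, fun Y hY => ?_⟩
          obtain ⟨h0, h1, h2, h3⟩ := H Y hY
          simp [h0, h1, h2]
          refine ⟨?_, ?_⟩ <;> ring
        · refine ⟨0, 0, 0, 0, 0, 0, 0, c0, 0, 0, 0, 0, 0, a1, 0, a2, 0, 0, fun Y hY => ?_⟩
          obtain ⟨h0, h1, h2, h3⟩ := H Y hY
          simp [h0, h1, h2]
          refine ⟨?_, ?_⟩ <;> ring
      · fin_cases j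
        · refine ⟨0, 0, 0, 0, 0, 0, 0, 0, 0, 0, 0, 0, 0, 0, 0, 0, c0, 0, fun Y hY => ?_⟩
          obtain ⟨h0, h1, h2, h3⟩ := H Y hY
          simp [h0]; ring
        · refine ⟨0, 0, 0, 0, 0, 0, 0, 0, 0, 0, 0, 0, 0, 0, 0, 0, 0, c0, fun Y hY => ?_⟩
          obtain ⟨h0, h1, h2, h3⟩ := H Y hY
          simp [h0]; ring
      · refine ⟨0, 0, 0, 0, 0, 0, 0, 0, 0, 0, 0, 0, 0, 0, 0, 0, 0, 0, fun Y hY => ?_⟩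
        simp
    · refine ⟨0, 0, 0, 0, 0, 0, 0, 0, 0, 0, 0, 0, 0, 0, 0, 0, 0, 0, fun Y hY => ?_⟩
      simp [hY (2 * k + 1) j ⟨k, rfl⟩]

open Polynomial in
/-- second derivative operator on polynomials in K, modulo l^2 -/
noncomputable def Dop (E : ℝ) (P : ℝ[X]) : ℝ[X] :=
  derivative (derivative P) * (C E - X ^ 2 - C (1/2) * X ^ 4) - derivative P * (X + X ^ 3)

open Polynomial in
theorem iter_poly (E l : ℝ) (K L : ℝ → ℝ) (hK : ∀ x, HasDerivAt K (L x) x)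
    (hL : ∀ x, HasDerivAt L (-(l^2) * (K x + K x ^ 3)) x)
    (hE : ∀ x, L x ^ 2 = l^2 * (E - K x ^ 2 - K x ^ 4 / 2)) (P : ℝ[X]) (k : ℕ) :
    (iteratedDeriv (2 * k) (fun x => P.eval (K x)) = fun x => (l^2)^k * ((Dop E)^[k] P).eval (K x)) ∧
    (iteratedDeriv (2 * k + 1) (fun x => P.eval (K x)) =
      fun x => (l^2)^k * ((derivative ((Dop E)^[k] P)).eval (K x) * L x)) := by
  have hd : ∀ (Q : ℝ[X]) x, HasDerivAt (fun x => Q.eval (K x)) ((derivative Q).eval (K x) * L x) x :=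
    fun Q x => (Q.hasDerivAt (K x)).comp x (hK x)
  induction k with
  | zero =>
    simp only [Nat.mul_zero, iteratedDeriv_zero, zero_add, iteratedDeriv_one]
    refine ⟨by simp, ?_⟩
    funext x
    simpa using (hd P x).deriv
  | succ k ih =>
    have h1 : iteratedDeriv (2 * (k + 1)) (fun x => P.eval (K x)) =
        fun x => (l^2)^(k+1) * ((Dop E)^[k+1] P).eval (K x) := by
      rw [show 2 * (k + 1) = (2 * k + 1) + 1 by ring, iteratedDeriv_succ, ih.2]
      funext x
      have := (((hd (derivative ((Dop E)^[k] P)) x).mul (hL x)).const_mul ((l^2)^k)).deriv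
      refine Eq.trans this ?_
      rw [Function.iterate_succ_apply', Dop]
      simp only [eval_sub, eval_mul, eval_add, eval_pow, eval_X, eval_C]
      linear_combination (l^2)^k * eval (K x) (derivative (derivative ((Dop E)^[k] P))) * hE x
    refine ⟨h1, ?_⟩
    rw [iteratedDeriv_succ, h1]
    funext x
    exact ((hd ((Dop E)^[k+1] P) x).const_mul _).deriv

open Polynomial in
theorem Dop_parity (E s : ℝ) (hs : s ^ 2 = 1) (P : ℝ[X]) (r : ℝ) (h : P.comp (C s * X) = C r * P) :
    (Dop E P).comp (C s * X) = C r * Dop E P := by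
  have hCs : (C s : ℝ[X]) ^ 2 = 1 := by rw [← C_pow, hs, C_1]
  have h1 := congrArg derivative h
  have h2 := congrArg derivative h1
  simp only [derivative_comp, derivative_mul, derivative_C, derivative_X, zero_mul, zero_add, mul_one, mul_zero, add_zero] at h1 h2
  simp only [Dop, sub_comp, mul_comp, add_comp, pow_comp, X_comp, C_comp]
  generalize (derivative (derivative P)).comp (C s * X) = A at *
  generalize (derivative P).comp (C s * X) = B at *
  have e4 : (C s * X : ℝ[X])^4 = X^4 := by linear_combination (X^4 * (C s^2+1)) * hCs
  have e3 : (C s * X : ℝ[X])^3 = C s * X^3 := by linear_combination (C s * X^3) * hCs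
  have e2 : (C s * X : ℝ[X])^2 = X^2 := by linear_combination (X^2) * hCs
  rw [e4, e3, e2]
  have h2' : A = C r * derivative (derivative P) := by
    linear_combination h2 - A * hCs
  rw [h2']
  linear_combination (-X - X^3) * h1

open Polynomial in
theorem Dop_iter_parity (E s : ℝ) (hs : s ^ 2 = 1) (P : ℝ[X]) (r : ℝ)
    (h : P.comp (C s * X) = C r * P) (k : ℕ) :
    ((Dop E)^[k] P).comp (C s * X) = C r * (Dop E)^[k] P := by
  induction k with
  | zero => exact h
  | succ k ih => rw [Function.iterate_succ_apply']; exact Dop_parity E s hs _ r ih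

theorem wave_pde (α σ η l : ℝ) (K L : ℝ → ℝ) (hη : η^2 = (2*α+1)*σ - (4*α+1)/3)
    (E : ℝ) (hK : ∀ x, HasDerivAt K (L x) x)
    (hL : ∀ x, HasDerivAt L (-(l^2) * (K x + K x ^ 3)) x)
    (hE : ∀ x, L x ^ 2 = l^2 * (E - K x ^ 2 - K x ^ 4 / 2))
    (u v : ℝ × ℝ → ℝ) (hu : u = fun p => l^2 * (σ + K (p.1 - l^2 * (3*σ-1) * p.2) ^ 2))
    (hv : v = fun p => l^2 * (η * K (p.1 - l^2 * (3*σ-1) * p.2))) :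
    (∀ p : ℝ × ℝ,
          pdt u p = 6 * α * u p * pdx u p - 6 * v p * pdx v p + α * pdx (pdx (pdx u)) p) ∧
        (∀ p : ℝ × ℝ, pdt v p = -3 * u p * pdx v p - pdx (pdx (pdx v)) p) ∧
    (∀ p : ℝ × ℝ, pdt (fun q => u q * v q) p = -(l^2 * (3*σ-1)) * pdx (fun q => u q * v q) p) := by
  set c := l^2 * (3*σ-1) with hc
  have sx : ∀ (F F' : ℝ → ℝ), (∀ x, HasDerivAt F (F' x) x) →
      pdx (fun p => F (p.1 - c * p.2)) = fun p => F' (p.1 - c * p.2) := by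
    intro F F' h
    funext p
    have := (h (p.1 - c * p.2)).comp p.1 ((hasDerivAt_id p.1).sub_const (c * p.2))
    have h2 := this.deriv
    simp only [mul_one] at h2
    exact h2
  have st : ∀ (F F' : ℝ → ℝ), (∀ x, HasDerivAt F (F' x) x) →
      pdt (fun p => F (p.1 - c * p.2)) = fun p => -c * F' (p.1 - c * p.2) := by
    intro F F' h
    funext p
    have := (h (p.1 - c * p.2)).comp p.2 (((hasDerivAt_id p.2).const_mul c).const_sub p.1)
    have h2 := this.deriv
    simp only [mul_one] at h2
    exact h2.trans (by ring)
  have hf1 : ∀ x, HasDerivAt (fun x => l^2 * (σ + K x ^ 2)) (l^2 * (2 * K x * L x)) x := fun x => by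
    refine ((((hK x).pow 2).const_add σ).const_mul (l^2)).congr_deriv ?_
    simp
  have hf2 : ∀ x, HasDerivAt (fun x => l^2 * (2 * K x * L x))
      (l^2 * (l^2 * (2 * E - 4 * K x ^ 2 - 3 * K x ^ 4))) x := fun x => by
    refine ((((hK x).const_mul 2).mul (hL x)).const_mul (l^2)).congr_deriv ?_
    linear_combination (2 * l^2) * hE x
  have hf3 : ∀ x, HasDerivAt (fun x => l^2 * (l^2 * (2 * E - 4 * K x ^ 2 - 3 * K x ^ 4)))
      (l^2 * (l^2 * (-8 * K x - 12 * K x ^ 3) * L x)) x := fun x => by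
    refine ((((((hK x).pow 2).const_mul 4).const_sub (2*E)).sub
      (((hK x).pow 4).const_mul 3)).const_mul (l^2)).const_mul (l^2) |>.congr_deriv ?_
    simp only [Nat.cast_ofNat, Nat.reduceSub, pow_one]
    ring
  have hg1 : ∀ x, HasDerivAt (fun x => l^2 * (η * K x)) (l^2 * (η * L x)) x := fun x =>
    ((hK x).const_mul η).const_mul (l^2)
  have hg2 : ∀ x, HasDerivAt (fun x => l^2 * (η * L x))
      (l^2 * (η * (-(l^2) * (K x + K x ^ 3)))) x := fun x =>
    ((hL x).const_mul η).const_mul (l^2)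
  have hg3 : ∀ x, HasDerivAt (fun x => l^2 * (η * (-(l^2) * (K x + K x ^ 3))))
      (l^2 * (η * (-(l^2) * (1 + 3 * K x ^ 2) * L x))) x := fun x => by
    refine ((((hK x).add ((hK x).pow 3)).const_mul (-(l^2))).const_mul η).const_mul (l^2)
      |>.congr_deriv ?_
    simp only [Nat.cast_ofNat, Nat.reduceSub, pow_one]
    ring
  have hfg := fun x => (hf1 x).mul (hg1 x)
  subst hu hv
  refine ⟨fun p => ?_, fun p => ?_, fun p => ?_⟩
  · rw [st _ _ hf1, sx _ _ hf1, sx _ _ hg1, sx _ _ hf2, sx _ _ hf3]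
    simp only [hc]
    generalize K _ = k
    generalize L _ = m
    linear_combination (6 * l^4 * k * m) * hη
  · rw [st _ _ hg1, sx _ _ hg1, sx _ _ hg2, sx _ _ hg3]
    simp only [hc]
    generalize K _ = k
    generalize L _ = m
    ring
  · have := sx _ _ hfg
    have h2 := st _ _ hfg
    simp only [Pi.mul_apply] at this h2
    rw [h2, this]

theorem evalJet_diff (N : ℕ) (J : MvPolynomial (Fin N × Fin 2) ℝ)
    (u v : ℝ × ℝ → ℝ) (hu : ContDiff ℝ (⊤ : ℕ∞) u) (hv : ContDiff ℝ (⊤ : ℕ∞) v) (t : ℝ) :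
    Differentiable ℝ (fun x => evalJet2 N J u v (x, t)) := by
  have hc : ∀ i : Fin N × Fin 2, ContDiff ℝ (⊤ : ℕ∞) (fun y => (if i.2 = 0 then u else v) (y, t)) := by
    intro i
    split_ifs
    · exact hu.comp (by fun_prop)
    · exact hv.comp (by fun_prop)
  have hd : ∀ i : Fin N × Fin 2, Differentiable ℝ
      (iteratedDeriv (i.1 : ℕ) (fun y => (if i.2 = 0 then u else v) (y, t))) := fun i =>
    (hc i).differentiable_iteratedDeriv _ (by exact_mod_cast ENat.natCast_lt_top _)
  unfold evalJet2
  simp only [MvPolynomial.eval_eq']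
  refine Differentiable.fun_sum fun d _ => ?_
  refine (differentiable_const _).mul ?_
  refine Differentiable.fun_finsetProd fun i _ => ?_
  exact (hd i).pow _

open Polynomial in
theorem eval_aeval_jet {ι : Type*} (f : ι → ℝ[X]) (J : MvPolynomial ι ℝ) (m : ℝ) :
    (MvPolynomial.aeval f J).eval m = MvPolynomial.eval (fun i => (f i).eval m) J := by
  induction J using MvPolynomial.induction_on with
  | C a => simp [Polynomial.algebraMap_eq]
  | add p q hp hq => simp [hp, hq]
  | mul_X p i hp => simp [hp]

open Polynomial in
theorem jets_at_turning (E l c σ η h : ℝ) (hEh : E = h^2 + h^4/2) (K L : ℝ → ℝ)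
    (hK : ∀ x, HasDerivAt K (L x) x)
    (hL : ∀ x, HasDerivAt L (-(l^2) * (K x + K x ^ 3)) x)
    (hE : ∀ x, L x ^ 2 = l^2 * (E - K x ^ 2 - K x ^ 4 / 2))
    (u v : ℝ × ℝ → ℝ) (hu : u = fun p => l^2 * (σ + K (p.1 - c * p.2) ^ 2))
    (hv : v = fun p => l^2 * (η * K (p.1 - c * p.2))) (N : ℕ)
    (J : MvPolynomial (Fin N × Fin 2) ℝ) (s : ℝ) (hs : s^2 = 1) (x : ℝ) (hx : K x = s * h) :
    evalJet2 N J u v (x, 0) = (MvPolynomial.aeval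
        (fun i : Fin N × Fin 2 => (C (if Odd (i.1 : ℕ) then 0 else if i.2 = 0 then
          ((Dop E)^[(i.1 : ℕ) / 2] (C σ + X^2)).eval h else
          s * ((Dop E)^[(i.1 : ℕ) / 2] (C η * X)).eval h) * X ^ ((i.1 : ℕ) / 2 + 1) : ℝ[X])) J).eval
          (l^2) := by
  have hLx : L x = 0 := by
    have := hE x
    have h4 : s^4 = 1 := by rw [show s^4 = (s^2)^2 by ring, hs]; norm_num
    rw [hx, mul_pow, mul_pow, hs, h4, hEh] at this
    have h0 : L x ^ 2 = 0 := by rw [this]; ring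
    exact pow_eq_zero_iff (two_ne_zero) |>.1 h0
  have hU := fun k => iter_poly E l K L hK hL hE (C σ + X^2) k
  have hV := fun k => iter_poly E l K L hK hL hE (C η * X) k
  have pU : ∀ k, ((Dop E)^[k] (C σ + X^2)).eval (s * h) = ((Dop E)^[k] (C σ + X^2)).eval h := by
    intro k
    have h1 := Dop_iter_parity E s hs (C σ + X^2) 1 (by
      simp only [add_comp, C_comp, pow_comp, X_comp, mul_pow, ← C_pow, hs, C_1, one_mul]) k
    have := congrArg (eval h) h1
    simpa [eval_comp] using this
  have pV : ∀ k, ((Dop E)^[k] (C η * X)).eval (s * h) = s * ((Dop E)^[k] (C η * X)).eval h := by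
    intro k
    have h1 := Dop_iter_parity E s hs (C η * X) s (by
      simp only [mul_comp, C_comp, X_comp]; ring) k
    have := congrArg (eval h) h1
    simpa [eval_comp] using this
  rw [eval_aeval_jet, evalJet2]
  congr 2
  funext i
  obtain ⟨⟨n, hn⟩, j⟩ := i
  have eu : (fun y => u (y, 0)) = fun y => l^2 * (C σ + X^2 : ℝ[X]).eval (K y) := by
    subst hu; funext y; simp
  have ev : (fun y => v (y, 0)) = fun y => l^2 * (C η * X : ℝ[X]).eval (K y) := by
    subst hv; funext y; simp
  simp only [eval_mul, eval_C, eval_pow, eval_X]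
  rcases Nat.even_or_odd' n with ⟨k, rfl | rfl⟩
  · have ho : ¬ Odd (2 * k) := by simp
    rw [if_neg ho, Nat.mul_div_cancel_left k (by norm_num)]
    fin_cases j
    · simp only [Fin.zero_eta, if_true]
      rw [eu, iteratedDeriv_const_mul_field, (hU k).1]
      simp only [hx, pU]
      ring
    · simp only [Fin.mk_one, one_ne_zero, if_false]
      rw [ev, iteratedDeriv_const_mul_field, (hV k).1]
      simp only [hx, pV]
      ring
  · have ho : Odd (2 * k + 1) := ⟨k, rfl⟩
    rw [if_pos ho]
    fin_cases j
    · simp only [Fin.zero_eta, if_true]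
      rw [eu, iteratedDeriv_const_mul_field, (hU k).2]
      simp [hLx]
    · simp only [Fin.mk_one, one_ne_zero, if_false]
      rw [ev, iteratedDeriv_const_mul_field, (hV k).2]
      simp [hLx]

open Polynomial in
theorem relation (α : ℝ) (N : ℕ) (J : MvPolynomial (Fin N × Fin 2) ℝ)
    (H : ∀ u v : ℝ × ℝ → ℝ, ContDiff ℝ (⊤ : ℕ∞) u → ContDiff ℝ (⊤ : ℕ∞) v →
        (∀ p : ℝ × ℝ,
          pdt u p = 6 * α * u p * pdx u p - 6 * v p * pdx v p + α * pdx (pdx (pdx u)) p) →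
        (∀ p : ℝ × ℝ, pdt v p = -3 * u p * pdx v p - pdx (pdx (pdx v)) p) →
        ∀ p : ℝ × ℝ, pdt (fun q => u q * v q) p + pdx (evalJet2 N J u v) p = 0) :
    ∃ a b d e r : ℝ, ∀ σ η h : ℝ, η^2 = (2*α+1)*σ - (4*α+1)/3 →
      a * ((σ + h^2)^2 * (η * h)) + b * (η * h)^3 + d * ((σ + h^2) * (-η * (h + h^3)))
        + e * (η * h * (-2 * h^2 * (1 + h^2))) + r * (η * ((1 + 3 * h^2) * (h + h^3)))
      = (3*σ-1) * (σ + h^2) * (η * h) := by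
  obtain ⟨c0, a1, a2, b1, b2, b3, b4, b5, d1, d2, d3, d4, d5, d6, d7, d8, d9, d10, HJ⟩ := jet_form N J
  refine ⟨d2, d4, d6, d7, d10, fun σ η h hη => ?_⟩
  obtain ⟨E, hEh⟩ : ∃ E, E = h^2 + h^4/2 := ⟨_, rfl⟩
  set Y : ℝ → ℕ → Fin 2 → ℝ := fun s n j => if Odd n then 0 else if j = 0 then
          ((Dop E)^[n / 2] (C σ + X^2)).eval h else
          s * ((Dop E)^[n / 2] (C η * X)).eval h with hY
  set Q : ℝ → ℝ[X] := fun s => MvPolynomial.aeval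
        (fun i : Fin N × Fin 2 => C (Y s i.1 i.2) * X ^ ((i.1 : ℕ) / 2 + 1)) J with hQ
  have hmain : ∀ l : ℝ, 0 < l → (Q 1 - Q (-1) - C (2 * ((3*σ-1) * (σ + h^2) * (η * h))) * X^3).eval (l^2) = 0 := by
    intro l hl
    obtain ⟨K, L, hKc, hK, hL, hE, ⟨x1, hx1⟩, ⟨x2, hx2⟩⟩ := duffing_exists h l hl
    rw [← hEh] at hE
    obtain ⟨u, hu⟩ : ∃ u : ℝ × ℝ → ℝ, u = fun p => l^2 * (σ + K (p.1 - l^2 * (3*σ-1) * p.2) ^ 2) := ⟨_, rfl⟩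
    obtain ⟨v, hv⟩ : ∃ v : ℝ × ℝ → ℝ, v = fun p => l^2 * (η * K (p.1 - l^2 * (3*σ-1) * p.2)) := ⟨_, rfl⟩
    obtain ⟨w1, w2, w3⟩ := wave_pde α σ η l K L hη E hK hL hE u v hu hv
    have hcK : ContDiff ℝ (⊤ : ℕ∞) (fun p : ℝ × ℝ => K (p.1 - l^2 * (3*σ-1) * p.2)) :=
      hKc.comp (by fun_prop)
    have hcu : ContDiff ℝ (⊤ : ℕ∞) u := by rw [hu]; fun_prop
    have hcv : ContDiff ℝ (⊤ : ℕ∞) v := by rw [hv]; fun_prop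
    have hcons := H u v hcu hcv w1 w2
    have hJd := evalJet_diff N J u v hcu hcv 0
    have huvd : Differentiable ℝ (fun x : ℝ => u (x, 0) * v (x, 0)) := by
      have h1 : Differentiable ℝ u := hcu.differentiable (by simp)
      have h2 : Differentiable ℝ v := hcv.differentiable (by simp)
      fun_prop
    have hconst := is_const_of_deriv_eq_zero
      (hJd.sub (huvd.const_mul (l^2 * (3*σ-1)))) (fun x => by
        have h1 := hcons (x, 0)
        rw [w3] at h1
        rw [deriv_sub (hJd x) ((huvd.const_mul _) x), deriv_const_mul _ (huvd x)]
        simp only [pdx] at h1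
        linarith) x1 x2
    have j1 := jets_at_turning E l _ σ η h hEh K L hK hL hE u v hu hv N J 1 (by norm_num) x1 (by simpa using hx1)
    have j2 := jets_at_turning E l _ σ η h hEh K L hK hL hE u v hu hv N J (-1) (by norm_num) x2 (by simpa using hx2)
    simp only [Pi.sub_apply, j1, j2] at hconst
    change (Q 1).eval (l^2) - _ = (Q (-1)).eval (l^2) - _ at hconst
    simp only [hu, hv, mul_zero, sub_zero, hx1, hx2] at hconst
    simp only [eval_sub, eval_mul, eval_C, eval_pow, eval_X]
    linear_combination hconst
  have hzero : Q 1 - Q (-1) - C (2 * ((3*σ-1) * (σ + h^2) * (η * h))) * X^3 = 0 := by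
    apply Polynomial.eq_zero_of_infinite_isRoot
    refine Set.Infinite.mono ?_ (Set.Ioi_infinite (0:ℝ))
    intro m hm
    have := hmain (√m) (Real.sqrt_pos.2 hm)
    rwa [Real.sq_sqrt (le_of_lt hm)] at this
  have hco := congrArg (fun P => coeff P 3) hzero
  have hodd : ∀ s n i, Odd n → Y s n i = 0 := fun s n i hn => by simp [hY, hn]
  have e1 := (HJ (Y 1) (hodd 1)).2.2.2
  have e2 := (HJ (Y (-1)) (hodd (-1))).2.2.2
  simp only [coeff_sub, coeff_C_mul, coeff_X_pow, coeff_zero, if_true, mul_one] at hco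
  change (Q 1).coeff 3 = _ at e1
  change (Q (-1)).coeff 3 = _ at e2
  rw [e1, e2] at hco
  have o2 : ¬ Odd 2 := by decide
  have o4 : ¬ Odd 4 := by decide
  have y00 : ∀ s, Y s 0 0 = σ + h^2 := fun s => by simp [hY]
  have y01 : ∀ s, Y s 0 1 = s * (η * h) := fun s => by simp [hY]
  have y20 : ∀ s, Y s 2 0 = -2 * h^2 * (1 + h^2) := fun s => by
    simp [hY, o2, Dop, hEh]; ring
  have y21 : ∀ s, Y s 2 1 = s * (-η * (h + h^3)) := fun s => by
    simp [hY, o2, Dop]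
  have y40 : Y 1 4 0 = Y (-1) 4 0 := by simp [hY]
  have y41 : ∀ s, Y s 4 1 = s * (η * ((1 + 3 * h^2) * (h + h^3))) := fun s => by
    simp [hY, o4, Dop, hEh]; ring_nf; simp
  simp only [y00, y01, y20, y21, y40, y41] at hco
  linear_combination hco / 2

theorem forward (α a b d e r : ℝ) (H : ∀ σ η h : ℝ, η^2 = (2*α+1)*σ - (4*α+1)/3 →
      a * ((σ + h^2)^2 * (η * h)) + b * (η * h)^3 + d * ((σ + h^2) * (-η * (h + h^3)))
        + e * (η * h * (-2 * h^2 * (1 + h^2))) + r * (η * ((1 + 3 * h^2) * (h + h^3)))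
      = (3*σ-1) * (σ + h^2) * (η * h)) : α = -1 := by
  have H2 : ∀ σ m : ℝ, 0 < m → m = (2*α+1)*σ - (4*α+1)/3 →
      (a * σ^2 - d * σ + r = 3*σ^2 - σ) ∧ (2*a*σ + b*m - d*(1+σ) - 2*e + 4*r = 3*σ-1) ∧
      (a - d - 2*e + 3*r = 0) := by
    intro σ m hm hmσ
    have hη : (√m)^2 = m := Real.sq_sqrt hm.le
    have hη0 : √m ≠ 0 := (Real.sqrt_pos.2 hm).ne'
    have key : ∀ h : ℝ, h ≠ 0 → a * (σ+h^2)^2 + b*m*h^2 - d*(σ+h^2)*(1+h^2) - 2*e*h^2*(1+h^2)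
        + r*(1+3*h^2)*(1+h^2) = (3*σ-1)*(σ+h^2) := by
      intro h hh
      have := H σ (√m) h (by rw [hη, hmσ])
      apply mul_left_cancel₀ (mul_ne_zero hη0 hh)
      linear_combination this - b * √m * h^3 * hη
    have k1 := key 1 (by norm_num)
    have k2 := key 2 (by norm_num)
    have k3 := key 3 (by norm_num)
    refine ⟨?_, ?_, ?_⟩ <;> ring_nf at k1 k2 k3 ⊢ <;> linarith
  by_cases hα : 2*α+1 = 0
  · exfalso
    have hα' : α = -1/2 := by linarith
    subst hα'
    obtain ⟨p1, p2, p3⟩ := H2 0 (1/3) (by norm_num) (by norm_num)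
    obtain ⟨q1, q2, q3⟩ := H2 1 (1/3) (by norm_num) (by norm_num)
    obtain ⟨r1, r2, r3⟩ := H2 2 (1/3) (by norm_num) (by norm_num)
    linarith
  · have hs : ∀ m : ℝ, m = (2*α+1)*((m + (4*α+1)/3)/(2*α+1)) - (4*α+1)/3 := fun m => by
      field_simp; ring
    set S : ℝ → ℝ := fun m => (m + (4*α+1)/3)/(2*α+1) with hS
    have hSm : ∀ m, (2*α+1) * S m = m + (4*α+1)/3 := fun m => by simp only [hS]; field_simp
    obtain ⟨p1, p2, p3⟩ := H2 (S 1) 1 (by norm_num) (hs 1)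
    obtain ⟨q1, q2, q3⟩ := H2 (S 2) 2 (by norm_num) (hs 2)
    obtain ⟨r1, r2, r3⟩ := H2 (S 3) 3 (by norm_num) (hs 3)
    have m1 := hSm 1
    have m2 := hSm 2
    have m3 := hSm 3
    generalize S 1 = s1 at *
    generalize S 2 = s2 at *
    generalize S 3 = s3 at *
    obtain ⟨t, ht⟩ : ∃ t, t * (2*α+1) = 1 := ⟨(2*α+1)⁻¹, inv_mul_cancel₀ hα⟩
    have ht0 : t ≠ 0 := by rintro rfl; simp at ht
    have e2 : s2 = s1 + t := by linear_combination (-s2+s1) * ht + t * m2 - t * m1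
    have e3 : s3 = s1 + 2*t := by linear_combination (-s3+s1) * ht + t * m3 - t * m1
    subst e2 e3
    have ha : a = 3 := by
      apply mul_left_cancel₀ (pow_ne_zero 2 ht0)
      linear_combination (r1 - 2*q1 + p1)/2
    subst ha
    have hd : d = 1 := by
      apply mul_left_cancel₀ ht0
      linear_combination p1 - q1
    subst hd
    have hr : r = 0 := by linarith
    subst hr
    have he : e = 1 := by linarith
    subst he
    have hb : b = -2 * t := by linarith
    subst hb
    have h1 : s1 - t = 1 := by linarith
    have h2 : s1 = 1 + t := by linarith
    subst h2
    linarith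

theorem backward : (∃ (N : ℕ) (J : MvPolynomial (Fin N × Fin 2) ℝ),
      ∀ u v : ℝ × ℝ → ℝ, ContDiff ℝ (⊤ : ℕ∞) u → ContDiff ℝ (⊤ : ℕ∞) v →
        (∀ p : ℝ × ℝ,
          pdt u p = 6 * (-1) * u p * pdx u p - 6 * v p * pdx v p + (-1) * pdx (pdx (pdx u)) p) →
        (∀ p : ℝ × ℝ, pdt v p = -3 * u p * pdx v p - pdx (pdx (pdx v)) p) →
        ∀ p : ℝ × ℝ, pdt (fun q => u q * v q) p + pdx (evalJet2 N J u v) p = 0) := by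
  let x : Fin 3 → Fin 2 → MvPolynomial (Fin 3 × Fin 2) ℝ := fun i j => MvPolynomial.X (i, j)
  refine ⟨3, 3 * x 0 0 ^ 2 * x 0 1 + 2 * x 0 1 ^ 3 + x 0 1 * x 2 0 + x 0 0 * x 2 1
    - x 1 0 * x 1 1, ?_⟩
  rintro u v hu hv h1 h2 ⟨p, t⟩
  have hsl : ∀ w : ℝ × ℝ → ℝ, ContDiff ℝ (⊤ : ℕ∞) w → ∃ f0 f1 f2 f3 : ℝ → ℝ,
      (∀ y, HasDerivAt f0 (f1 y) y) ∧ (∀ y, HasDerivAt f1 (f2 y) y) ∧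
      (∀ y, HasDerivAt f2 (f3 y) y) ∧ (∀ y, w (y, t) = f0 y) ∧ (∀ y, pdx w (y, t) = f1 y) ∧
      (∀ y, pdx (pdx (pdx w)) (y, t) = f3 y) ∧ iteratedDeriv 0 (fun y => w (y, t)) = f0 ∧
      iteratedDeriv 1 (fun y => w (y, t)) = f1 ∧ iteratedDeriv 2 (fun y => w (y, t)) = f2 := by
    intro w hw
    have hc : ContDiff ℝ (⊤ : ℕ∞) (fun y => w (y, t)) := hw.comp (by fun_prop)
    have hd : ∀ n y, HasDerivAt (iteratedDeriv n (fun y => w (y, t)))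
        (iteratedDeriv (n+1) (fun y => w (y, t)) y) y := fun n y => by
      rw [iteratedDeriv_succ]
      exact (hc.differentiable_iteratedDeriv n (by exact_mod_cast ENat.natCast_lt_top _) y).hasDerivAt
    refine ⟨_, _, _, _, hd 0, hd 1, hd 2, fun y => by simp, fun y => ?_, fun y => ?_, rfl, rfl, rfl⟩
    · simp [pdx]
    · simp [pdx, iteratedDeriv_succ]
  obtain ⟨f0, f1, f2, f3, a1, a2, a3, a4, a5, a6, a7, a8, a9⟩ := hsl u hu
  obtain ⟨g0, g1, g2, g3, b1, b2, b3, b4, b5, b6, b7, b8, b9⟩ := hsl v hv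
  have hut : Differentiable ℝ (fun s : ℝ => u (p, s)) := by
    have : Differentiable ℝ u := hu.differentiable (by simp)
    fun_prop
  have hvt : Differentiable ℝ (fun s : ℝ => v (p, s)) := by
    have : Differentiable ℝ v := hv.differentiable (by simp)
    fun_prop
  have e1 : pdt (fun q => u q * v q) (p, t) = pdt u (p, t) * v (p, t) + u (p, t) * pdt v (p, t) :=
    ((hut t).hasDerivAt.mul (hvt t).hasDerivAt).deriv
  have e2 : pdx (evalJet2 3 (3 * x 0 0 ^ 2 * x 0 1 + 2 * x 0 1 ^ 3 + x 0 1 * x 2 0 + x 0 0 * x 2 1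
    - x 1 0 * x 1 1) u v) (p, t) = 6 * f0 p * f1 p * g0 p + 3 * f0 p ^ 2 * g1 p + 6 * g0 p ^ 2 * g1 p
      + g0 p * f3 p + f0 p * g3 p := by
    have hfun : (fun y => evalJet2 3 (3 * x 0 0 ^ 2 * x 0 1 + 2 * x 0 1 ^ 3 + x 0 1 * x 2 0
        + x 0 0 * x 2 1 - x 1 0 * x 1 1) u v (y, t)) = fun y => 3 * f0 y ^ 2 * g0 y + 2 * g0 y ^ 3
        + g0 y * f2 y + f0 y * g2 y - f1 y * g1 y := by
      funext y
      have c3 : (MvPolynomial.eval (fun i : Fin 3 × Fin 2 =>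
        iteratedDeriv (i.1 : ℕ) (fun y => (if i.2 = 0 then u else v) (y, t)) y)) 3 = 3 := map_ofNat _ 3
      have c2 : (MvPolynomial.eval (fun i : Fin 3 × Fin 2 =>
        iteratedDeriv (i.1 : ℕ) (fun y => (if i.2 = 0 then u else v) (y, t)) y)) 2 = 2 := map_ofNat _ 2
      simp only [evalJet2, x, map_add, map_sub, map_mul, map_pow, MvPolynomial.eval_X, c3, c2,
        Fin.val_zero, Fin.val_one, Fin.val_two, if_true, one_ne_zero, if_false, a7, a8, a9, b7, b8, b9]
    have hdv := ((((((a1 p).pow 2).const_mul 3).mul (b1 p)).add (((b1 p).pow 3).const_mul 2)).add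
      ((b1 p).mul (a3 p))).add ((a1 p).mul (b3 p)) |>.sub ((a2 p).mul (b2 p))
    simp only [pdx]
    rw [hfun]
    refine hdv.deriv.trans ?_
    simp
    ring
  rw [e1, e2, h1, h2, a4, a5, a6, b4, b5, b6]
  ring

theorem hirota_satsuma_uv_conserved_iff (α : ℝ) (hα : α ≠ 0) :
    (∃ (N : ℕ) (J : MvPolynomial (Fin N × Fin 2) ℝ),
      ∀ u v : ℝ × ℝ → ℝ, ContDiff ℝ (⊤ : ℕ∞) u → ContDiff ℝ (⊤ : ℕ∞) v →
        (∀ p : ℝ × ℝ,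
          pdt u p = 6 * α * u p * pdx u p - 6 * v p * pdx v p + α * pdx (pdx (pdx u)) p) →
        (∀ p : ℝ × ℝ, pdt v p = -3 * u p * pdx v p - pdx (pdx (pdx v)) p) →
        ∀ p : ℝ × ℝ, pdt (fun q => u q * v q) p + pdx (evalJet2 N J u v) p = 0) ↔
    α = -1 := by
  constructor
  · rintro ⟨N, J, H⟩
    obtain ⟨a, b, d, e, r, hr⟩ := relation α N J H
    exact forward α a b d e r hr
  · rintro rfl
    exact backward
end

section
/- For the fifth-order KdV family u_t + α·u²·u_x + β·u_x·u_xx + γ·u·u_xxx + u_5x = 0, the density ρ = u² is conserved (∂_t(u²) a total x-derivative along all smooth solutions) if and only if β = 2γ. -/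
/-- Evaluation of a polynomial differential expression `J` in one dependent
variable and its `x`-derivatives up to order `N - 1`, along `u`. -/
noncomputable def evalJet (N : ℕ) (J : MvPolynomial (Fin N) ℝ)
    (u : ℝ × ℝ → ℝ) (p : ℝ × ℝ) : ℝ :=
  MvPolynomial.eval (fun i : Fin N => iteratedDeriv (i : ℕ) (fun y => u (y, p.2)) p.1) J

def Chain (α β γ c : ℝ) (f f1 f2 f3 f4 : ℝ → ℝ) : Prop :=
  (∀ x, HasDerivAt f (f1 x) x) ∧ (∀ x, HasDerivAt f1 (f2 x) x) ∧ (∀ x, HasDerivAt f2 (f3 x) x) ∧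
  (∀ x, HasDerivAt f3 (f4 x) x) ∧
  (∀ x, HasDerivAt f4 (c * f1 x - α * f x ^ 2 * f1 x - β * f1 x * f2 x - γ * f x * f3 x) x)

lemma contDiff_succ_of_hasDerivAt {n : ℕ} {f f1 : ℝ → ℝ} (h : ∀ x, HasDerivAt f (f1 x) x)
    (h1 : ContDiff ℝ n f1) : ContDiff ℝ ((n + 1 : ℕ) : WithTop ℕ∞) f := by
  have : deriv f = f1 := funext fun x => (h x).deriv
  push_cast
  rw [contDiff_succ_iff_deriv]
  refine ⟨fun x => (h x).differentiableAt, by simp, by rwa [this]⟩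

lemma Chain.contDiff {α β γ c : ℝ} {f f1 f2 f3 f4 : ℝ → ℝ} (h : Chain α β γ c f f1 f2 f3 f4) :
    ContDiff ℝ (⊤ : ℕ∞) f := by
  obtain ⟨h0, h1, h2, h3, h4⟩ := h
  have key : ∀ n : ℕ, ContDiff ℝ n f ∧ ContDiff ℝ n f1 ∧ ContDiff ℝ n f2 ∧ ContDiff ℝ n f3 ∧
      ContDiff ℝ n f4 := by
    intro n
    induction n with
    | zero =>
      simp only [Nat.cast_zero, contDiff_zero]
      exact ⟨continuous_iff_continuousAt.2 fun x => (h0 x).continuousAt,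
        continuous_iff_continuousAt.2 fun x => (h1 x).continuousAt,
        continuous_iff_continuousAt.2 fun x => (h2 x).continuousAt,
        continuous_iff_continuousAt.2 fun x => (h3 x).continuousAt,
        continuous_iff_continuousAt.2 fun x => (h4 x).continuousAt⟩
    | succ n ih =>
      obtain ⟨i0, i1, i2, i3, i4⟩ := ih
      refine ⟨contDiff_succ_of_hasDerivAt h0 i1, contDiff_succ_of_hasDerivAt h1 i2,
        contDiff_succ_of_hasDerivAt h2 i3, contDiff_succ_of_hasDerivAt h3 i4,
        contDiff_succ_of_hasDerivAt h4 (by fun_prop)⟩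
  exact contDiff_infty.2 fun n => (key n).1

def Conserved (α β γ : ℝ) (N : ℕ) (J : MvPolynomial (Fin N) ℝ) : Prop :=
  ∀ u : ℝ × ℝ → ℝ, ContDiff ℝ (⊤ : ℕ∞) u →
        (∀ p : ℝ × ℝ,
          pdt u p + α * (u p) ^ 2 * pdx u p + β * pdx u p * pdx (pdx u) p
            + γ * u p * pdx (pdx (pdx u)) p + pdx (pdx (pdx (pdx (pdx u)))) p = 0) →
        ∀ p : ℝ × ℝ, pdt (fun q => (u q) ^ 2) p + pdx (evalJet N J u) p = 0

lemma pdx_tw {f f1 : ℝ → ℝ} (c : ℝ) (h : ∀ x, HasDerivAt f (f1 x) x) :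
    pdx (fun p => f (p.1 - c * p.2)) = fun p => f1 (p.1 - c * p.2) := by
  funext p
  have := (h (p.1 - c * p.2)).comp p.1 ((hasDerivAt_id p.1).sub_const (c * p.2))
  simpa [pdx, Function.comp_def] using this.deriv

lemma pdt_tw {f f1 : ℝ → ℝ} (c : ℝ) (h : ∀ x, HasDerivAt f (f1 x) x) :
    pdt (fun p => f (p.1 - c * p.2)) = fun p => - c * f1 (p.1 - c * p.2) := by
  funext p
  have := (h (p.1 - c * p.2)).comp p.2 (((hasDerivAt_id p.2).const_mul c).const_sub p.1)
  have h2 := this.deriv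
  simp only [pdt, Function.comp_def, id] at *
  rw [h2]; ring

lemma tw_flux {α β γ c : ℝ} {f f1 f2 f3 f4 : ℝ → ℝ} {N : ℕ} {J : MvPolynomial (Fin N) ℝ}
    (hJ : Conserved α β γ N J) (h : Chain α β γ c f f1 f2 f3 f4) (x : ℝ) :
    deriv (fun y => MvPolynomial.eval (fun i : Fin N => iteratedDeriv (i : ℕ) f y) J) x
      = 2 * c * f x * f1 x := by
  have hs := h.contDiff
  obtain ⟨h0, h1, h2, h3, h4⟩ := h
  have := hJ (fun p => f (p.1 - c * p.2)) (by fun_prop) (by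
    intro p
    rw [pdt_tw c h0, pdx_tw c h0, pdx_tw c h1, pdx_tw c h2, pdx_tw c h3, pdx_tw c h4]
    ring) (x, 0)
  have hsq : ∀ x, HasDerivAt (fun x => f x ^ 2) (2 * f x * f1 x) x := fun x => by
    
    have := (h0 x).pow 2
    refine this.congr_deriv ?_
    simp
  rw [pdt_tw c hsq] at this
  simp only [pdx, evalJet, mul_zero, sub_zero] at this
  linarith

lemma Chain.scale {α β γ c : ℝ} {f f1 f2 f3 f4 : ℝ → ℝ} (h : Chain α β γ c f f1 f2 f3 f4)
    (l a : ℝ) : Chain α β γ (l ^ 4 * c) (fun x => l ^ 2 * f (a + l * x))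
      (fun x => l ^ 3 * f1 (a + l * x)) (fun x => l ^ 4 * f2 (a + l * x))
      (fun x => l ^ 5 * f3 (a + l * x)) (fun x => l ^ 6 * f4 (a + l * x)) := by
  have key : ∀ (g g1 : ℝ → ℝ) (n : ℕ), (∀ x, HasDerivAt g (g1 x) x) →
      ∀ x, HasDerivAt (fun x => l ^ n * g (a + l * x)) (l ^ (n + 1) * g1 (a + l * x)) x := by
    intro g g1 n hg x
    have := ((hg (a + l * x)).comp x (((hasDerivAt_id x).const_mul l).const_add a)).const_mul (l ^ n)
    refine this.congr_deriv ?_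
    ring
  obtain ⟨h0, h1, h2, h3, h4⟩ := h
  refine ⟨key _ _ 2 h0, key _ _ 3 h1, key _ _ 4 h2, key _ _ 5 h3, fun x => ?_⟩
  refine (key _ _ 6 h4 x).congr_deriv ?_
  ring

def wt {N : ℕ} (d : Fin N →₀ ℕ) : ℕ := ∑ i : Fin N, d i * ((i : ℕ) + 2)

def Q (a : Fin 7 → ℝ) (U : ℕ → ℝ) : ℝ :=
  a 0 * U 0 ^ 4 + a 1 * (U 0 * U 1 ^ 2) + a 2 * (U 0 ^ 2 * U 2) + a 3 * U 2 ^ 2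
    + a 4 * (U 1 * U 3) + a 5 * (U 0 * U 4) + a 6 * U 6

lemma mono_Q {N : ℕ} (d : Fin N →₀ ℕ) (hd : wt d = 8) :
    ∃ a : Fin 7 → ℝ, ∀ U : ℕ → ℝ, ∏ i : Fin N, U (i : ℕ) ^ d i = Q a U := by
  obtain ⟨e, he⟩ : ∃ e : ℕ → ℕ, ∀ i, e i = if h : i < N then d ⟨i, h⟩ else 0 := ⟨_, fun _ => rfl⟩
  have he' : ∀ i : Fin N, d i = e i := fun i => by simp [he]
  have he0 : ∀ i, N ≤ i → e i = 0 := fun i hi => by simp [he, not_lt.2 hi]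
  have hsum : ∑ i ∈ Finset.range (N + 7), e i * (i + 2) = 8 := by
    rw [← hd, wt]
    simp only [he']
    rw [Fin.sum_univ_eq_sum_range (fun i => e i * (i + 2)) N]
    symm
    apply Finset.sum_subset (by intro i; simp; omega)
    intro i _ hi
    rw [he0 i (by simpa using hi), zero_mul]
  have hprod : ∀ U : ℕ → ℝ, ∏ i : Fin N, U (i : ℕ) ^ d i = ∏ i ∈ Finset.range (N + 7), U i ^ e i := by
    intro U
    simp only [he']
    rw [Fin.prod_univ_eq_prod_range (fun i => U i ^ e i) N]
    apply Finset.prod_subset (by intro i; simp; omega)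
    intro i _ hi
    rw [he0 i (by simpa using hi), pow_zero]
  have hbig : ∀ i, 7 ≤ i → e i = 0 := by
    intro i hi
    by_contra hne
    have hiN : i < N := by
      by_contra h
      exact hne (he0 i (not_lt.1 h))
    have := Finset.single_le_sum (f := fun i => e i * (i + 2)) (s := Finset.range (N + 7))
      (fun _ _ => Nat.zero_le _) (Finset.mem_range.2 (show i < N + 7 by omega))
    rw [hsum] at this
    have h1 : 1 ≤ e i := Nat.one_le_iff_ne_zero.2 hne
    have h2 : 1 * (i + 2) ≤ e i * (i + 2) := Nat.mul_le_mul_right _ h1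
    omega
  have hsum7 : ∑ i ∈ Finset.range 7, e i * (i + 2) = 8 := by
    rw [← hsum]
    apply Finset.sum_subset (by intro i; simp; omega)
    intro i _ hi
    rw [hbig i (by simpa using hi), zero_mul]
  have hprod7 : ∀ U : ℕ → ℝ, ∏ i : Fin N, U (i : ℕ) ^ d i = ∏ i ∈ Finset.range 7, U i ^ e i := by
    intro U
    rw [hprod]
    symm
    apply Finset.prod_subset (by intro i; simp; omega)
    intro i _ hi
    rw [hbig i (by simpa using hi), pow_zero]
  simp only [hprod7]
  simp only [Finset.prod_range_succ, Finset.prod_range_zero, Finset.sum_range_succ,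
    Finset.sum_range_zero] at hsum7 ⊢
  generalize e 0 = e0 at *
  generalize e 1 = e1 at *
  generalize e 2 = e2 at *
  generalize e 3 = e3 at *
  generalize e 4 = e4 at *
  generalize e 5 = e5 at *
  generalize e 6 = e6 at *
  have h7 : (e0 = 4 ∧ e1 = 0 ∧ e2 = 0 ∧ e3 = 0 ∧ e4 = 0 ∧ e5 = 0 ∧ e6 = 0) ∨
    (e0 = 1 ∧ e1 = 2 ∧ e2 = 0 ∧ e3 = 0 ∧ e4 = 0 ∧ e5 = 0 ∧ e6 = 0) ∨
    (e0 = 2 ∧ e1 = 0 ∧ e2 = 1 ∧ e3 = 0 ∧ e4 = 0 ∧ e5 = 0 ∧ e6 = 0) ∨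
    (e0 = 0 ∧ e1 = 0 ∧ e2 = 2 ∧ e3 = 0 ∧ e4 = 0 ∧ e5 = 0 ∧ e6 = 0) ∨
    (e0 = 0 ∧ e1 = 1 ∧ e2 = 0 ∧ e3 = 1 ∧ e4 = 0 ∧ e5 = 0 ∧ e6 = 0) ∨
    (e0 = 1 ∧ e1 = 0 ∧ e2 = 0 ∧ e3 = 0 ∧ e4 = 1 ∧ e5 = 0 ∧ e6 = 0) ∨
    (e0 = 0 ∧ e1 = 0 ∧ e2 = 0 ∧ e3 = 0 ∧ e4 = 0 ∧ e5 = 0 ∧ e6 = 1) := by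
    clear hsum hprod hprod7 hbig he he' he0 hd
    have b1 : e1 ≤ 2 := by omega
    have b2 : e2 ≤ 2 := by omega
    have b3 : e3 ≤ 1 := by omega
    have b4 : e4 ≤ 1 := by omega
    have b5 : e5 ≤ 1 := by omega
    have b6 : e6 ≤ 1 := by omega
    interval_cases e6 <;> interval_cases e5 <;> interval_cases e4 <;> interval_cases e3 <;>
      interval_cases e2 <;> interval_cases e1 <;> omega
  rcases h7 with h | h | h | h | h | h | h <;> obtain ⟨rfl, rfl, rfl, rfl, rfl, rfl, rfl⟩ := h
  · exact ⟨Pi.single 0 1, fun U => by simp [Q]⟩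
  · exact ⟨Pi.single 1 1, fun U => by simp [Q]⟩
  · exact ⟨Pi.single 2 1, fun U => by simp [Q]⟩
  · exact ⟨Pi.single 3 1, fun U => by simp [Q]⟩
  · exact ⟨Pi.single 4 1, fun U => by simp [Q]⟩
  · exact ⟨Pi.single 5 1, fun U => by simp [Q]⟩
  · exact ⟨Pi.single 6 1, fun U => by simp [Q]⟩

lemma sum_Q {N : ℕ} (J : MvPolynomial (Fin N) ℝ) (S : Finset (Fin N →₀ ℕ))
    (hS : ∀ d ∈ S, wt d = 8) :
    ∃ a : Fin 7 → ℝ, ∀ U : ℕ → ℝ,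
      ∑ d ∈ S, J.coeff d * ∏ i : Fin N, U (i : ℕ) ^ d i = Q a U := by
  classical
  induction S using Finset.induction_on with
  | empty => exact ⟨0, fun U => by simp [Q]⟩
  | insert d S hd ih =>
    obtain ⟨a, ha⟩ := ih fun d hd => hS d (Finset.mem_insert_of_mem hd)
    obtain ⟨b, hb⟩ := mono_Q d (hS d (Finset.mem_insert_self _ _))
    refine ⟨fun i => J.coeff d * b i + a i, fun U => ?_⟩
    rw [Finset.sum_insert hd, ha, hb]
    simp only [Q]
    ring

lemma exists_Q {α β γ : ℝ} {N : ℕ} {J : MvPolynomial (Fin N) ℝ} (hJ : Conserved α β γ N J) :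
    ∃ a : Fin 7 → ℝ, ∀ (c : ℝ) (f f1 f2 f3 f4 : ℝ → ℝ), Chain α β γ c f f1 f2 f3 f4 →
      ∀ x, deriv (fun y => Q a (fun i => iteratedDeriv i f y)) x = 2 * c * f x * f1 x := by
  obtain ⟨a, ha⟩ := sum_Q J (J.support.filter fun d => wt d = 8) (by simp)
  refine ⟨a, fun c f f1 f2 f3 f4 h x => ?_⟩
  have hs := h.contDiff
  have hdiff : ∀ i, Differentiable ℝ (iteratedDeriv i f) := fun i =>
    hs.differentiable_iteratedDeriv i (by exact_mod_cast WithTop.coe_lt_top i)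
  set m : (Fin N →₀ ℕ) → ℝ → ℝ := fun d y => ∏ i : Fin N, iteratedDeriv (i : ℕ) f y ^ d i with hm
  have hmd : ∀ d, Differentiable ℝ (m d) := fun d => by
    simp only [hm]
    intro y
    exact DifferentiableAt.fun_finsetProd fun i _ => (hdiff i y).pow _
  have hl : ∀ l : ℝ, ∑ d ∈ J.support, J.coeff d * (l ^ (wt d + 1) * deriv (m d) x)
      = l ^ 9 * (2 * c * f x * f1 x) := by
    intro l
    have h1 := tw_flux hJ (h.scale l x) 0
    have h2 : ∀ y, MvPolynomial.eval (fun i : Fin N => iteratedDeriv (i : ℕ)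
        (fun x_1 => l ^ 2 * f (x + l * x_1)) y) J
        = ∑ d ∈ J.support, J.coeff d * (l ^ wt d * m d (x + l * y)) := by
      intro y
      rw [MvPolynomial.eval_eq']
      refine Finset.sum_congr rfl fun d _ => ?_
      congr 1
      rw [hm, wt]
      simp only
      rw [← Finset.prod_pow_eq_pow_sum, ← Finset.prod_mul_distrib]
      refine Finset.prod_congr rfl fun i _ => ?_
      rw [iteratedDeriv_const_mul_field]
      have h3 := iteratedDeriv_comp_const_mul (n := i) (f := fun z => f (x + z))
        ((hs.of_le (by exact_mod_cast le_top)).comp (contDiff_const.add contDiff_id)) l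
      have h4 := congrFun h3 y
      rw [h4, iteratedDeriv_comp_const_add]
      ring
    rw [funext h2] at h1
    have h5 : HasDerivAt (fun y => ∑ d ∈ J.support, J.coeff d * (l ^ wt d * m d (x + l * y)))
        (∑ d ∈ J.support, J.coeff d * (l ^ (wt d + 1) * deriv (m d) x)) 0 := by
      apply HasDerivAt.fun_sum
      intro d _
      apply HasDerivAt.const_mul
      have h6 : HasDerivAt (m d) (deriv (m d) x) (x + l * 0) := by
        simpa using (hmd d x).hasDerivAt
      have h7 := (h6.comp (0:ℝ) (((hasDerivAt_id (0:ℝ)).const_mul l).const_add x)).const_mul (l ^ wt d)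
      refine h7.congr_deriv ?_
      ring
    rw [h5.deriv] at h1
    rw [h1]
    simp only [mul_zero, add_zero]
    ring
  have hp : (∑ d ∈ J.support, Polynomial.C (J.coeff d * deriv (m d) x) * Polynomial.X ^ (wt d + 1))
      = Polynomial.C (2 * c * f x * f1 x) * Polynomial.X ^ 9 := by
    apply Polynomial.funext
    intro l
    rw [Polynomial.eval_finsetSum]
    simp only [Polynomial.eval_mul, Polynomial.eval_C, Polynomial.eval_pow, Polynomial.eval_X]
    rw [mul_comm, ← hl l]
    refine Finset.sum_congr rfl fun d _ => by ring
  have hc := congrArg (fun p => Polynomial.coeff p 9) hp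
  simp only [Polynomial.finsetSum_coeff, Polynomial.coeff_C_mul_X_pow] at hc
  simp only [if_true] at hc
  rw [← hc]
  have h8 : (fun y => Q a (fun i => iteratedDeriv i f y)) =
      fun y => ∑ d ∈ J.support.filter (fun d => wt d = 8), J.coeff d * m d y := by
    funext y
    rw [← ha]
  rw [h8]
  have h9 : HasDerivAt (fun y => ∑ d ∈ J.support.filter (fun d => wt d = 8), J.coeff d * m d y)
      (∑ d ∈ J.support.filter (fun d => wt d = 8), J.coeff d * deriv (m d) x) x := by
    apply HasDerivAt.fun_sum
    intro d _
    exact ((hmd d x).hasDerivAt).const_mul _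
  rw [h9.deriv, Finset.sum_filter]
  refine Finset.sum_congr rfl fun d _ => ?_
  by_cases hd : wt d = 8
  · simp [hd]
  · rw [if_neg hd, if_neg (by omega)]

lemma star {α β γ : ℝ} {N : ℕ} {J : MvPolynomial (Fin N) ℝ} (hJ : Conserved α β γ N J) :
    ∃ a0 a1 a2 a3 a4 a5 a6 : ℝ, ∀ (c : ℝ) (f f1 f2 f3 f4 f5 f6 f7 : ℝ → ℝ),
      Chain α β γ c f f1 f2 f3 f4 →
      (∀ x, f5 x = c * f1 x - α * f x ^ 2 * f1 x - β * f1 x * f2 x - γ * f x * f3 x) →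
      (∀ x, f6 x = c * f2 x - α * (2 * f x * f1 x ^ 2 + f x ^ 2 * f2 x)
        - β * (f2 x ^ 2 + f1 x * f3 x) - γ * (f1 x * f3 x + f x * f4 x)) →
      (∀ x, f7 x = c * f3 x - α * (2 * f1 x ^ 3 + 6 * f x * f1 x * f2 x + f x ^ 2 * f3 x)
        - β * (3 * f2 x * f3 x + f1 x * f4 x)
        - γ * (f2 x * f3 x + 2 * f1 x * f4 x + f x * f5 x)) →
      ∀ x, (4 * a0 - 2 * α) * (f x ^ 3 * f1 x) + a1 * f1 x ^ 3
        + (2 * a1 + 2 * a2 - 2 * β) * (f x * f1 x * f2 x) + (a2 - 2 * γ) * (f x ^ 2 * f3 x)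
        + (2 * a3 + a4) * (f2 x * f3 x) + (a4 + a5) * (f1 x * f4 x) + (a5 - 2) * (f x * f5 x)
        + a6 * f7 x = 0 := by
  obtain ⟨a, ha⟩ := exists_Q hJ
  refine ⟨a 0, a 1, a 2, a 3, a 4, a 5, a 6, ?_⟩
  intro c f f1 f2 f3 f4 f5 f6 f7 h e5 e6 e7 x
  have hQ := ha c f f1 f2 f3 f4 h x
  obtain ⟨h0, h1, h2, h3, h4⟩ := h
  have h4' : ∀ x, HasDerivAt f4 (f5 x) x := fun x => (h4 x).congr_deriv (e5 x).symm
  have h5 : ∀ x, HasDerivAt f5 (f6 x) x := by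
    intro x
    rw [funext e5]
    refine (((((h1 x).const_mul c).sub ((((h0 x).pow 2).const_mul α).mul (h1 x))).sub
      (((h1 x).const_mul β).mul (h2 x))).sub (((h0 x).const_mul γ).mul (h3 x))).congr_deriv ?_
    rw [e6]; simp; ring
  have h6 : ∀ x, HasDerivAt f6 (f7 x) x := by
    intro x
    rw [funext e6]
    refine (((((h2 x).const_mul c).sub ((((((h0 x).const_mul 2).mul ((h1 x).pow 2)).add
      (((h0 x).pow 2).mul (h2 x)))).const_mul α)).sub
      ((((h2 x).pow 2).add ((h1 x).mul (h3 x))).const_mul β)).sub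
      ((((h1 x).mul (h3 x)).add ((h0 x).mul (h4' x))).const_mul γ)).congr_deriv ?_
    rw [e7]; simp; ring
  have i0 : iteratedDeriv 0 f = f := iteratedDeriv_zero
  have i1 : iteratedDeriv 1 f = f1 := by
    rw [iteratedDeriv_succ, i0]; exact funext fun x => (h0 x).deriv
  have i2 : iteratedDeriv 2 f = f2 := by
    rw [iteratedDeriv_succ, i1]; exact funext fun x => (h1 x).deriv
  have i3 : iteratedDeriv 3 f = f3 := by
    rw [iteratedDeriv_succ, i2]; exact funext fun x => (h2 x).deriv
  have i4 : iteratedDeriv 4 f = f4 := by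
    rw [iteratedDeriv_succ, i3]; exact funext fun x => (h3 x).deriv
  have i5 : iteratedDeriv 5 f = f5 := by
    rw [iteratedDeriv_succ, i4]; exact funext fun x => (h4' x).deriv
  have i6 : iteratedDeriv 6 f = f6 := by
    rw [iteratedDeriv_succ, i5]; exact funext fun x => (h5 x).deriv
  simp only [Q, i0, i1, i2, i3, i4, i6] at hQ
  have hd := (((((((((h0 x).pow 4).const_mul (a 0)).add
    (((h0 x).mul ((h1 x).pow 2)).const_mul (a 1))).add
    ((((h0 x).pow 2).mul (h2 x)).const_mul (a 2))).add
    (((h2 x).pow 2).const_mul (a 3))).add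
    (((h1 x).mul (h3 x)).const_mul (a 4))).add
    (((h0 x).mul (h4' x)).const_mul (a 5))).add ((h6 x).const_mul (a 6)))
  have hd' := hQ.symm.trans hd.deriv
  simp at hd'
  have e5x := e5 x
  have : 2 * c * f x * f1 x = 2 * f x * (f5 x + α * f x ^ 2 * f1 x + β * f1 x * f2 x
    + γ * f x * f3 x) := by rw [e5x]; ring
  rw [this] at hd'
  linear_combination -hd'

lemma pdx_contDiff {u : ℝ × ℝ → ℝ} (hu : ContDiff ℝ (⊤ : ℕ∞) u) :
    ContDiff ℝ (⊤ : ℕ∞) (pdx u) := by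
  have : pdx u = fun p => fderiv ℝ u p (1, 0) := by
    funext p
    have h1 : HasFDerivAt u (fderiv ℝ u p) (p.1, p.2) :=
      (hu.differentiable (by simp) p).hasFDerivAt
    have h2 : HasDerivAt (fun x : ℝ => (x, p.2)) ((1 : ℝ), (0 : ℝ)) p.1 :=
      (hasDerivAt_id p.1).prodMk (hasDerivAt_const _ _)
    exact (h1.comp_hasDerivAt p.1 h2).deriv
  rw [this]
  exact (hu.fderiv_right (m := (⊤ : ℕ∞)) (by simp)).clm_apply contDiff_const

lemma pdx_hasDerivAt {u : ℝ × ℝ → ℝ} (hu : ContDiff ℝ (⊤ : ℕ∞) u) (x t : ℝ) :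
    HasDerivAt (fun y => u (y, t)) (pdx u (x, t)) x := by
  have h : Differentiable ℝ u := hu.differentiable (by simp)
  exact DifferentiableAt.hasDerivAt (by fun_prop : DifferentiableAt ℝ (fun y => u (y, t)) x)

lemma backward_s14 (α β γ : ℝ) (h : β = 2 * γ) : ∃ (N : ℕ) (J : MvPolynomial (Fin N) ℝ),
    Conserved α β γ N J := by
  refine ⟨5, MvPolynomial.C (α / 2) * MvPolynomial.X 0 ^ 4
    + MvPolynomial.C (2 * γ) * (MvPolynomial.X 0 ^ 2 * MvPolynomial.X 2)
    + MvPolynomial.X 2 ^ 2 - MvPolynomial.C 2 * (MvPolynomial.X 1 * MvPolynomial.X 3)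
    + MvPolynomial.C 2 * (MvPolynomial.X 0 * MvPolynomial.X 4), ?_⟩
  intro u hu heq p
  obtain ⟨x, t⟩ := p
  have c1 := pdx_contDiff hu
  have c2 := pdx_contDiff c1
  have c3 := pdx_contDiff c2
  have c4 := pdx_contDiff c3
  have d0 := fun x => pdx_hasDerivAt hu x t
  have d1 := fun x => pdx_hasDerivAt c1 x t
  have d2 := fun x => pdx_hasDerivAt c2 x t
  have d3 := fun x => pdx_hasDerivAt c3 x t
  have d4 := fun x => pdx_hasDerivAt c4 x t
  have i0 : iteratedDeriv 0 (fun y => u (y, t)) = fun y => u (y, t) := iteratedDeriv_zero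
  have i1 : iteratedDeriv 1 (fun y => u (y, t)) = fun y => pdx u (y, t) := by
    rw [iteratedDeriv_succ, i0]; exact funext fun x => (d0 x).deriv
  have i2 : iteratedDeriv 2 (fun y => u (y, t)) = fun y => pdx (pdx u) (y, t) := by
    rw [iteratedDeriv_succ, i1]; exact funext fun x => (d1 x).deriv
  have i3 : iteratedDeriv 3 (fun y => u (y, t)) = fun y => pdx (pdx (pdx u)) (y, t) := by
    rw [iteratedDeriv_succ, i2]; exact funext fun x => (d2 x).deriv
  have i4 : iteratedDeriv 4 (fun y => u (y, t)) = fun y => pdx (pdx (pdx (pdx u))) (y, t) := by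
    rw [iteratedDeriv_succ, i3]; exact funext fun x => (d3 x).deriv
  have hdu : Differentiable ℝ u := hu.differentiable (by simp)
  have ht : HasDerivAt (fun s => u (x, s)) (pdt u (x, t)) t :=
    DifferentiableAt.hasDerivAt (by fun_prop : DifferentiableAt ℝ (fun s => u (x, s)) t)
  have ht2 : pdt (fun q => u q ^ 2) (x, t) = 2 * u (x, t) * pdt u (x, t) := by
    have := (ht.pow 2).deriv
    simp at this
    exact this
  rw [ht2]
  have hd := (((((((d0 x).pow 4).const_mul (α / 2)).add
    ((((d0 x).pow 2).mul (d2 x)).const_mul (2 * γ))).add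
    ((d2 x).pow 2)).sub
    (((d1 x).mul (d3 x)).const_mul 2)).add
    (((d0 x).mul (d4 x)).const_mul 2)).deriv
  have hp := heq (x, t)
  have hev : pdx (evalJet 5 (MvPolynomial.C (α / 2) * MvPolynomial.X 0 ^ 4
    + MvPolynomial.C (2 * γ) * (MvPolynomial.X 0 ^ 2 * MvPolynomial.X 2)
    + MvPolynomial.X 2 ^ 2 - MvPolynomial.C 2 * (MvPolynomial.X 1 * MvPolynomial.X 3)
    + MvPolynomial.C 2 * (MvPolynomial.X 0 * MvPolynomial.X 4)) u) (x, t) = deriv (fun y => α / 2 * u (y, t) ^ 4 + 2 * γ * (u (y, t) ^ 2 * pdx (pdx u) (y, t))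
      + pdx (pdx u) (y, t) ^ 2 - 2 * (pdx u (y, t) * pdx (pdx (pdx u)) (y, t))
      + 2 * (u (y, t) * pdx (pdx (pdx (pdx u))) (y, t))) x := by
    change deriv _ _ = _
    congr 1
    funext y
    simp only [evalJet]
    simp only [map_add, map_sub, map_mul, map_pow, MvPolynomial.eval_C, MvPolynomial.eval_X]
    have v0 : ((0 : Fin 5) : ℕ) = 0 := rfl
    have v1 : ((1 : Fin 5) : ℕ) = 1 := rfl
    have v2 : ((2 : Fin 5) : ℕ) = 2 := rfl
    have v3 : ((3 : Fin 5) : ℕ) = 3 := rfl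
    have v4 : ((4 : Fin 5) : ℕ) = 4 := rfl
    rw [v0, v1, v2, v3, v4, i0, i1, i2, i3, i4]
  rw [hev]
  replace hd := hev.symm.trans (hev.trans hd)
  rw [hd]
  simp
  subst h
  linear_combination (2 * u (x, t)) * hp

abbrev XX := C(Set.Icc (0:ℝ) Real.pi, ℝ)

noncomputable def rr (x : ℝ) : Set.Icc (0:ℝ) Real.pi :=
  ⟨Real.arccos (Real.cos x), Real.arccos_nonneg _, Real.arccos_le_pi _⟩

lemma rr_cont : Continuous rr :=
  Continuous.subtype_mk (Real.continuous_arccos.comp Real.continuous_cos) _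

lemma rr_of_mem {x : ℝ} (h : x ∈ Set.Icc (0:ℝ) Real.pi) : rr x = ⟨x, h⟩ :=
  Subtype.ext (Real.arccos_cos h.1 h.2)

lemma rr_neg (x : ℝ) : rr (-x) = rr x := by
  simp [rr]

lemma rr_refl (x : ℝ) : rr (2 * Real.pi - x) = rr x := by
  simp [rr, Real.cos_two_pi_sub]

lemma exists_sg (x : ℝ) : ∃ s : ℝ, (s = 1 ∧ ∃ k : ℤ, x = (rr x : ℝ) + k * (2 * Real.pi)) ∨
    (s = -1 ∧ ∃ k : ℤ, x = -(rr x : ℝ) + k * (2 * Real.pi)) := by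
  have h : Real.cos (rr x : ℝ) = Real.cos x :=
    Real.cos_arccos (Real.neg_one_le_cos x) (Real.cos_le_one x)
  obtain ⟨k, hk | hk⟩ := Real.cos_eq_cos_iff.1 h
  · exact ⟨1, Or.inl ⟨rfl, k, by linarith⟩⟩
  · exact ⟨-1, Or.inr ⟨rfl, k, by linarith⟩⟩

noncomputable def sg (x : ℝ) : ℝ := Classical.choose (exists_sg x)

lemma sg_spec (x : ℝ) : (sg x = 1 ∧ ∃ k : ℤ, x = (rr x : ℝ) + k * (2 * Real.pi)) ∨
    (sg x = -1 ∧ ∃ k : ℤ, x = -(rr x : ℝ) + k * (2 * Real.pi)) :=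
  Classical.choose_spec (exists_sg x)

lemma sg_sq (x : ℝ) : sg x * sg x = 1 := by
  rcases sg_spec x with ⟨h, -⟩ | ⟨h, -⟩ <;> rw [h] <;> norm_num

lemma even_fold {g : ℝ → ℝ} (h0 : ∀ x, g (-x) = g x) (h1 : ∀ x, g (2 * Real.pi - x) = g x)
    (x : ℝ) : g x = g (rr x) := by
  have hp : Function.Periodic g (2 * Real.pi) := by
    intro y
    rw [← h0 y, ← h1 (-y)]; congr 1; ring
  rcases sg_spec x with ⟨-, k, h⟩ | ⟨-, k, h⟩
  · conv_lhs => rw [h]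
    exact hp.int_mul k _
  · conv_lhs => rw [h]
    rw [hp.int_mul k _, h0]

lemma odd_fold {g : ℝ → ℝ} (h0 : ∀ x, g (-x) = - g x) (h1 : ∀ x, g (2 * Real.pi - x) = - g x)
    (x : ℝ) : g x = sg x * g (rr x) := by
  have hp : Function.Periodic g (2 * Real.pi) := by
    intro y
    have := h1 (-y)
    rw [h0 y] at this
    rw [show y + 2 * Real.pi = 2 * Real.pi - -y by ring, this]; ring
  rcases sg_spec x with ⟨hs, k, h⟩ | ⟨hs, k, h⟩
  · rw [hs]; conv_lhs => rw [h]
    rw [hp.int_mul k _]; ring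
  · rw [hs]; conv_lhs => rw [h]
    rw [hp.int_mul k _, h0]; ring

lemma ode2_zero {K p : ℝ} {D D1 : ℝ → ℝ} (h : ∀ x, HasDerivAt D (D1 x) x)
    (h1 : ∀ x, HasDerivAt D1 (-K * D x) x) (hp : D p = 0) (hp1 : D1 p = 0) (x : ℝ) :
    D x = 0 ∧ D1 x = 0 := by
  let L : ℝ × ℝ →L[ℝ] ℝ × ℝ := (ContinuousLinearMap.snd ℝ ℝ ℝ).prod ((-K) • ContinuousLinearMap.fst ℝ ℝ ℝ)
  have := ODE_solution_unique_univ (v := fun _ => L) (s := fun _ => Set.univ) (K := ‖L‖₊) (t₀ := p)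
    (f := fun x => (D x, D1 x)) (g := fun _ => (0, 0))
    (fun _ => L.lipschitz.lipschitzOnWith)
    (fun t => ⟨by simpa [L] using (h t).prodMk (h1 t), trivial⟩)
    (fun t => ⟨(hasDerivAt_const t ((0:ℝ), (0:ℝ))).congr_deriv (by simp [L]; rfl), trivial⟩)
    (by simp [hp, hp1])
  have h2 := congrFun this x
  simpa using h2

lemma ode2_symm {K p : ℝ} {V V1 H : ℝ → ℝ} (h : ∀ x, HasDerivAt V (V1 x) x)
    (h1 : ∀ x, HasDerivAt V1 (H x - K * V x) x) (hH : ∀ x, H (2 * p - x) = H x) (hp : V1 p = 0) (x : ℝ) :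
    V (2 * p - x) = V x ∧ V1 (2 * p - x) = - V1 x := by
  have hc : ∀ x : ℝ, HasDerivAt (fun x => 2 * p - x) (-1) x := fun x => by
    simpa using (hasDerivAt_id x).const_sub (2 * p)
  have := ode2_zero (K := K) (p := p) (D := fun x => V x - V (2 * p - x))
    (D1 := fun x => V1 x + V1 (2 * p - x))
    (fun x => ((h x).sub ((h (2 * p - x)).comp x (hc x))).congr_deriv (by ring))
    (fun x => ((h1 x).add ((h1 (2 * p - x)).comp x (hc x))).congr_deriv (by rw [hH]; ring))
    (by simp [show 2 * p - p = p by ring]) (by simp [show 2 * p - p = p by ring, hp]) x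
  constructor <;> linarith [this.1, this.2]

noncomputable def JJ (g : ℝ → ℝ) (w : XX) (x : ℝ) : ℝ := ∫ s in (0:ℝ)..x, g s * w (rr s)

lemma JJ_deriv {g : ℝ → ℝ} (hg : Continuous g) (w : XX) (x : ℝ) :
    HasDerivAt (JJ g w) (g x * w (rr x)) x := by
  have hc : Continuous fun s => g s * w (rr s) := hg.mul (w.continuous.comp rr_cont)
  exact intervalIntegral.integral_hasDerivAt_right (hc.intervalIntegrable _ _)
    (hc.stronglyMeasurableAtFilter _ _) hc.continuousAt

lemma JJ_cont {g : ℝ → ℝ} (hg : Continuous g) (w : XX) : Continuous (JJ g w) :=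
  continuous_iff_continuousAt.2 fun x => (JJ_deriv hg w x).continuousAt

def rs (g : C(ℝ, ℝ)) : XX := ⟨fun x => g x, by fun_prop⟩

@[simp] lemma rs_apply (g : C(ℝ, ℝ)) (x : Set.Icc (0:ℝ) Real.pi) : rs g x = g x := rfl

noncomputable def JL (g : C(ℝ, ℝ)) : XX →L[ℝ] XX :=
  LinearMap.mkContinuous
    { toFun := fun w => ⟨fun x => JJ g w x, (JJ_cont g.continuous w).comp continuous_subtype_val⟩
      map_add' := by
        intro a b; ext x
        simp only [JJ, ContinuousMap.coe_mk, ContinuousMap.add_apply, mul_add]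
        have hc : ∀ w : XX, Continuous fun s => g s * w (rr s) := fun w =>
          g.continuous.mul (w.continuous.comp rr_cont)
        exact intervalIntegral.integral_add ((hc a).intervalIntegrable _ _) ((hc b).intervalIntegrable _ _)
      map_smul' := by
        intro a b; ext x
        simp only [JJ, ContinuousMap.coe_mk, ContinuousMap.smul_apply, smul_eq_mul, RingHom.id_apply]
        rw [← intervalIntegral.integral_const_mul]
        congr 1; ext s; ring }
    (‖rs g‖ * Real.pi) (by
      intro w
      rw [ContinuousMap.norm_le _ (by positivity)]
      intro x
      have := intervalIntegral.norm_integral_le_of_norm_le_const (a := 0) (b := (x:ℝ))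
        (f := fun s => g s * w (rr s)) (C := ‖rs g‖ * ‖w‖) (by
          intro s hs
          rw [Set.uIoc_of_le x.2.1] at hs
          have hs' : s ∈ Set.Icc (0:ℝ) Real.pi := ⟨hs.1.le, hs.2.trans x.2.2⟩
          rw [norm_mul]
          have h1 := (rs g).norm_coe_le_norm ⟨s, hs'⟩
          have h2 := w.norm_coe_le_norm (rr s)
          exact mul_le_mul h1 h2 (norm_nonneg _) (norm_nonneg _))
      refine this.trans ?_
      rw [sub_zero, abs_of_nonneg x.2.1, mul_assoc, mul_assoc]
      have := x.2.2
      have h3 := norm_nonneg (rs g)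
      have h4 := norm_nonneg w
      rw [mul_comm Real.pi]
      gcongr)

@[simp] lemma JL_apply (g : C(ℝ, ℝ)) (w : XX) (x : Set.Icc (0:ℝ) Real.pi) : JL g w x = JJ g w x := rfl

noncomputable def ptpi : Set.Icc (0:ℝ) Real.pi := ⟨Real.pi, Real.pi_pos.le, le_rfl⟩

/-- Solver for `V'' + K V = h` with Neumann conditions. -/
lemma solver {K : ℝ} (C S : C(ℝ, ℝ)) (hC : ∀ x, HasDerivAt C (-K * S x) x)
    (hS : ∀ x, HasDerivAt S (C x) x) (hCS : ∀ x, C x ^ 2 + K * S x ^ 2 = 1) (hS0 : S 0 = 0)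
    (κ : XX →L[ℝ] ℝ) :
    ∃ T0 T1 : XX →L[ℝ] XX, ∀ h : XX,
      (C Real.pi * JJ C h Real.pi + K * S Real.pi * JJ S h Real.pi - κ h * K * S Real.pi = 0) →
      ∃ V V1 : ℝ → ℝ, (∀ x, HasDerivAt V (V1 x) x) ∧ (∀ x, HasDerivAt V1 (h (rr x) - K * V x) x) ∧
        (∀ x, V x = T0 h (rr x)) ∧ (∀ x, V1 x = sg x * T1 h (rr x)) := by
  let M : XX → XX →L[ℝ] XX := fun a => ContinuousLinearMap.mul ℝ XX a
  refine ⟨(M (rs S)).comp (JL C) - (M (rs C)).comp (JL S) + κ.smulRight (rs C),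
    (M (rs C)).comp (JL C) + K • (M (rs S)).comp (JL S) - K • κ.smulRight (rs S), fun h hh => ?_⟩
  let V : ℝ → ℝ := fun x => S x * JJ C h x - C x * JJ S h x + κ h * C x
  let V1 : ℝ → ℝ := fun x => C x * JJ C h x + K * S x * JJ S h x - κ h * K * S x
  have hV : ∀ x, HasDerivAt V (V1 x) x := by
    intro x
    have := (((hS x).mul (JJ_deriv C.continuous h x)).sub ((hC x).mul (JJ_deriv S.continuous h x))).add
      ((hC x).const_mul (κ h))
    refine this.congr_deriv ?_
    simp only [V1]; ring
  have hV1 : ∀ x, HasDerivAt V1 (h (rr x) - K * V x) x := by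
    intro x
    have := (((hC x).mul (JJ_deriv C.continuous h x)).add
      (((hS x).const_mul K).mul (JJ_deriv S.continuous h x))).sub
      ((hS x).const_mul (κ h * K))
    refine this.congr_deriv ?_
    simp only [V]
    linear_combination h (rr x) * hCS x
  have s0 := fun x => ode2_symm (p := 0) hV hV1 (fun x => by simp [rr_neg]) (by simp [V1, hS0, JJ]) x
  have s1 := fun x => ode2_symm (p := Real.pi) hV hV1 (fun x => by simp [rr_refl]) hh x
  simp only [mul_zero, zero_sub] at s0
  refine ⟨V, V1, hV, hV1, fun x => ?_, fun x => ?_⟩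
  · rw [even_fold (fun x => (s0 x).1) (fun x => (s1 x).1) x]
    simp [V, M]
  · rw [odd_fold (fun x => (s0 x).2) (fun x => (s1 x).2) x]
    simp [V1, M]; left; ring

def Slv (K : ℝ) (T0 T1 : XX →L[ℝ] XX) (h : XX) : Prop :=
  ∃ V V1 : ℝ → ℝ, (∀ x, HasDerivAt V (V1 x) x) ∧ (∀ x, HasDerivAt V1 (h (rr x) - K * V x) x) ∧
        (∀ x, V x = T0 h (rr x)) ∧ (∀ x, V1 x = sg x * T1 h (rr x))

noncomputable def cosk (k : ℝ) : C(ℝ, ℝ) := ⟨fun x => Real.cos (k * x), by fun_prop⟩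

@[simp] lemma cosk_apply (k x : ℝ) : cosk k x = Real.cos (k * x) := rfl

lemma hcos (k x : ℝ) : HasDerivAt (fun x => Real.cos (k * x)) (-k * Real.sin (k * x)) x := by
  have := (Real.hasDerivAt_cos (k * x)).comp x ((hasDerivAt_id x).const_mul k)
  exact this.congr_deriv (by simp; ring)

lemma hsin (k x : ℝ) : HasDerivAt (fun x => Real.sin (k * x)) (k * Real.cos (k * x)) x := by
  have := (Real.hasDerivAt_sin (k * x)).comp x ((hasDerivAt_id x).const_mul k)
  exact this.congr_deriv (by simp; ring)

lemma solver_trig (k : ℕ) (hk : k ≠ 0) :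
    ∃ T0 T1 : XX →L[ℝ] XX, ∀ h : XX, JJ (cosk k) h Real.pi = 0 → Slv ((k:ℝ)^2) T0 T1 h := by
  have hk' : (k:ℝ) ≠ 0 := by exact_mod_cast hk
  obtain ⟨T0, T1, hT⟩ := solver (K := (k:ℝ)^2) (cosk k) ⟨fun x => Real.sin (k * x) / k, by fun_prop⟩
    (fun x => (hcos k x).congr_deriv (by simp; field_simp))
    (fun x => ((hsin k x).div_const _).congr_deriv (by simp; field_simp))
    (fun x => by
      simp only [cosk_apply, ContinuousMap.coe_mk]
      field_simp
      exact Real.cos_sq_add_sin_sq _) (by simp) 0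
  refine ⟨T0, T1, fun h hh => hT h ?_⟩
  simp only [ContinuousMap.coe_mk, Real.sin_nat_mul_pi, hh]
  simp

lemma solver_hyp : ∃ T0 T1 : XX →L[ℝ] XX, ∀ h : XX, Slv (-1) T0 T1 h := by
  let C : C(ℝ, ℝ) := ⟨Real.cosh, by fun_prop⟩
  let S : C(ℝ, ℝ) := ⟨Real.sinh, by fun_prop⟩
  have hs : Real.sinh Real.pi ≠ 0 := (Real.sinh_pos_iff.2 Real.pi_pos).ne'
  let κ : XX →L[ℝ] ℝ := (-1 / Real.sinh Real.pi) • (Real.cosh Real.pi • (ContinuousMap.evalCLM ℝ ptpi).comp (JL C)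
    - Real.sinh Real.pi • (ContinuousMap.evalCLM ℝ ptpi).comp (JL S))
  obtain ⟨T0, T1, hT⟩ := solver (K := -1) C S
    (fun x => (Real.hasDerivAt_cosh x).congr_deriv (by simp [S]))
    (fun x => Real.hasDerivAt_sinh x)
    (fun x => by
      have := Real.cosh_sq x
      simp only [C, S, ContinuousMap.coe_mk]
      linarith) (by simp [S]) κ
  refine ⟨T0, T1, fun h => hT h ?_⟩
  have : κ h = (-1 / Real.sinh Real.pi) * (Real.cosh Real.pi * JJ C h Real.pi - Real.sinh Real.pi * JJ S h Real.pi) := by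
    simp [κ, ptpi]
  rw [this]
  change Real.cosh Real.pi * _ + -1 * Real.sinh Real.pi * _ - _ * -1 * Real.sinh Real.pi = 0
  field_simp
  ring

lemma solver4 {K : ℝ} (hK : K ≠ 1) {A0 A1 B0 B1 P : XX →L[ℝ] XX}
    (hA : ∀ w, Slv 1 A0 A1 (P w)) (hB : ∀ w, Slv K B0 B1 (P w)) :
    ∃ T0 T1 T2 T3 : XX →L[ℝ] XX, ∀ w, ∃ ψ ψ1 ψ2 ψ3 : ℝ → ℝ,
      (∀ x, HasDerivAt ψ (ψ1 x) x) ∧ (∀ x, HasDerivAt ψ1 (ψ2 x) x) ∧ (∀ x, HasDerivAt ψ2 (ψ3 x) x) ∧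
      (∀ x, HasDerivAt ψ3 (P w (rr x) - (1 + K) * ψ2 x - K * ψ x) x) ∧
      (∀ x, ψ x = T0 w (rr x)) ∧ (∀ x, ψ1 x = sg x * T1 w (rr x)) ∧
      (∀ x, ψ2 x = T2 w (rr x)) ∧ (∀ x, ψ3 x = sg x * T3 w (rr x)) := by
  have hK' : K - 1 ≠ 0 := sub_ne_zero.2 hK
  refine ⟨(K-1)⁻¹ • (A0 - B0).comp P, (K-1)⁻¹ • (A1 - B1).comp P, (K-1)⁻¹ • (K • B0 - A0).comp P,
    (K-1)⁻¹ • (K • B1 - A1).comp P, fun w => ?_⟩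
  obtain ⟨V, V1, h1, h2, h3, h4⟩ := hA w
  obtain ⟨U, U1, g1, g2, g3, g4⟩ := hB w
  refine ⟨fun x => (K-1)⁻¹ * (V x - U x), fun x => (K-1)⁻¹ * (V1 x - U1 x),
    fun x => (K-1)⁻¹ * (K * U x - V x), fun x => (K-1)⁻¹ * (K * U1 x - V1 x),
    fun x => ((h1 x).sub (g1 x)).const_mul _,
    fun x => (((h2 x).sub (g2 x)).const_mul _).congr_deriv (by ring),
    fun x => ((((g1 x).const_mul K).sub (h1 x)).const_mul _),
    fun x => ((((g2 x).const_mul K).sub (h2 x)).const_mul _).congr_deriv (by field_simp; ring),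
    fun x => ?_, fun x => ?_, fun x => ?_, fun x => ?_⟩
  · simp [h3, g3]
  · simp [h4, g4]; ring
  · simp [h3, g3]
  · simp [h4, g4]; ring

noncomputable def fl (k : ℕ) : XX →L[ℝ] ℝ := (2 / Real.pi) • (ContinuousMap.evalCLM ℝ ptpi).comp (JL (cosk k))

lemma fl_apply (k : ℕ) (w : XX) : fl k w = 2 / Real.pi * JJ (cosk k) w Real.pi := by
  simp [fl, ptpi]

noncomputable def ck (k : ℕ) : XX := rs (cosk k)

lemma cos_fold (k : ℕ) (x : ℝ) : Real.cos (k * x) = Real.cos (k * (rr x : ℝ)) :=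
  even_fold (g := fun x => Real.cos (k * x)) (fun x => by simp [mul_neg]) (fun x => by
    simp only [mul_sub]
    exact Real.cos_nat_mul_two_pi_sub _ _) x

lemma sin_fold (k : ℕ) (x : ℝ) : Real.sin (k * x) = sg x * Real.sin (k * (rr x : ℝ)) :=
  odd_fold (g := fun x => Real.sin (k * x)) (fun x => by simp [mul_neg]) (fun x => by
    simp only [mul_sub]
    exact Real.sin_nat_mul_two_pi_sub _ _) x

lemma ck_fold (k : ℕ) (x : ℝ) : ck k (rr x) = Real.cos (k * x) := (cos_fold k x).symm

lemma fl_self (k : ℕ) (hk : k ≠ 0) : fl k (ck k) = 1 := by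
  have hk' : (k:ℝ) ≠ 0 := by exact_mod_cast hk
  have hp := Real.pi_ne_zero
  rw [fl_apply, JJ]
  simp only [ck_fold, cosk_apply]
  rw [intervalIntegral.integral_eq_sub_of_hasDerivAt (f := fun x => (x + Real.sin (k * x) * Real.cos (k * x) / k) / 2)]
  · simp
  · intro x _
    refine (((hasDerivAt_id x).add (((hsin k x).mul (hcos k x)).div_const _)).div_const _).congr_deriv ?_
    field_simp
    linear_combination (-1) * Real.cos_sq_add_sin_sq (k * x)
  · exact Continuous.intervalIntegrable (by fun_prop) _ _

lemma JJ_orth (j k : ℕ) (hjk : j ≠ k) : JJ (cosk j) (ck k) Real.pi = 0 := by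
  have hk' : (j:ℝ)^2 - k^2 ≠ 0 := by
    intro h
    apply hjk
    have : (j:ℝ)^2 = k^2 := by linarith
    have := (sq_eq_sq₀ (by positivity) (by positivity)).1 this
    exact_mod_cast this
  rw [JJ]
  simp only [ck_fold, cosk_apply]
  rw [intervalIntegral.integral_eq_sub_of_hasDerivAt (f := fun x =>
    (j * (Real.sin (j * x) * Real.cos (k * x)) - k * (Real.cos (j * x) * Real.sin (k * x))) / (j^2-k^2))]
  · simp
  · intro x _
    refine (((((hsin j x).mul (hcos k x)).const_mul (j:ℝ)).sub (((hcos j x).mul (hsin k x)).const_mul (k:ℝ))).div_const _).congr_deriv ?_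
    field_simp
    ring
  · exact Continuous.intervalIntegrable (by fun_prop) _ _

lemma fl_orth (j k : ℕ) (hjk : j ≠ k) : fl j (ck k) = 0 := by
  rw [fl_apply, JJ_orth j k hjk, mul_zero]

lemma JJ_of_fl {k : ℕ} {w : XX} (h : fl k w = 0) : JJ (cosk k) w Real.pi = 0 := by
  rw [fl_apply] at h
  have hp := Real.pi_pos
  have : 2 / Real.pi ≠ 0 := by positivity
  simpa [this] using h

/-- Order-four solver data. -/
def Slv4 (K : ℝ) (T0 T1 T2 T3 : XX →L[ℝ] XX) (w h : XX) : Prop :=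
  ∃ ψ ψ1 ψ2 ψ3 : ℝ → ℝ,
      (∀ x, HasDerivAt ψ (ψ1 x) x) ∧ (∀ x, HasDerivAt ψ1 (ψ2 x) x) ∧ (∀ x, HasDerivAt ψ2 (ψ3 x) x) ∧
      (∀ x, HasDerivAt ψ3 (h (rr x) - (1 + K) * ψ2 x - K * ψ x) x) ∧
      (∀ x, ψ x = T0 w (rr x)) ∧ (∀ x, ψ1 x = sg x * T1 w (rr x)) ∧
      (∀ x, ψ2 x = T2 w (rr x)) ∧ (∀ x, ψ3 x = sg x * T3 w (rr x))

lemma slv4_trig (n : ℕ) (hn : 2 ≤ n) : ∃ T0 T1 T2 T3 : XX →L[ℝ] XX, ∀ w,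
    Slv4 ((n:ℝ)^2) T0 T1 T2 T3 w (w - fl 1 w • ck 1 - fl n w • ck n) := by
  obtain ⟨A0, A1, hA⟩ := solver_trig 1 (by norm_num)
  obtain ⟨B0, B1, hB⟩ := solver_trig n (by omega)
  let P : XX →L[ℝ] XX := ContinuousLinearMap.id ℝ XX - (fl 1).smulRight (ck 1) - (fl n).smulRight (ck n)
  have hP : ∀ w, P w = w - fl 1 w • ck 1 - fl n w • ck n := fun w => by simp [P]
  have hK : ((n:ℝ)^2) ≠ 1 := by
    have : (2:ℝ) ≤ n := by exact_mod_cast hn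
    nlinarith
  obtain ⟨T0, T1, T2, T3, h⟩ := solver4 hK (A0 := A0) (A1 := A1) (B0 := B0) (B1 := B1) (P := P)
    (fun w => by
      have := hA (P w) (JJ_of_fl (by
        rw [hP]; simp [fl_self 1 (by norm_num), fl_orth 1 n (by omega)]))
      simpa using this)
    (fun w => hB (P w) (JJ_of_fl (by
        rw [hP]; simp [fl_self n (by omega), fl_orth n 1 (by omega)])))
  refine ⟨T0, T1, T2, T3, fun w => ?_⟩
  rw [← hP]; exact h w

lemma slv4_hyp : ∃ T0 T1 T2 T3 : XX →L[ℝ] XX, ∀ w,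
    Slv4 (-1) T0 T1 T2 T3 w (w - fl 1 w • ck 1) := by
  obtain ⟨A0, A1, hA⟩ := solver_trig 1 (by norm_num)
  obtain ⟨B0, B1, hB⟩ := solver_hyp
  let P : XX →L[ℝ] XX := ContinuousLinearMap.id ℝ XX - (fl 1).smulRight (ck 1)
  have hP : ∀ w, P w = w - fl 1 w • ck 1 := fun w => by simp [P]
  obtain ⟨T0, T1, T2, T3, h⟩ := solver4 (K := -1) (by norm_num) (A0 := A0) (A1 := A1) (B0 := B0) (B1 := B1) (P := P)
    (fun w => by
      have := hA (P w) (JJ_of_fl (by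
        rw [hP]; simp [fl_self 1 (by norm_num)]))
      simpa using this)
    (fun w => hB (P w))
  refine ⟨T0, T1, T2, T3, fun w => ?_⟩
  rw [← hP]; exact h w

/-- perturbative fixed point -/
lemma fixpt {E : Type*} [NormedAddCommGroup E] [NormedSpace ℝ E] [CompleteSpace E] (P : ℝ × E → E)
    (hP : ContDiff ℝ 1 P) (w0 : E) (h0 : ∀ w, P (0, w) = w0) :
    ∃ w : ℝ → E, Filter.Tendsto w (nhds 0) (nhds w0) ∧ ∀ᶠ ε in nhds (0:ℝ), w ε = P (ε, w ε) := by
  let G : ℝ × E → ℝ × E := fun p => (p.1, p.2 - P p)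
  have hP' := hP.contDiffAt.hasStrictFDerivAt (x := (0, w0)) (by norm_num)
  set D := fderiv ℝ P (0, w0) with hD
  have hD2 : ∀ b : E, D (0, b) = 0 := by
    intro b
    have h1 : HasFDerivAt (fun w => P (0, w)) (D.comp (ContinuousLinearMap.inr ℝ ℝ E)) w0 :=
      hP'.hasFDerivAt.comp w0 (hasFDerivAt_prodMk_right 0 w0)
    have h2 : HasFDerivAt (fun w : E => P (0, w)) (0 : E →L[ℝ] E) w0 := by
      simp only [h0]; exact hasFDerivAt_const _ _
    have := congrArg (fun L : E →L[ℝ] E => L b) (h1.unique h2)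
    simpa using this
  have hDs : ∀ a b, D (a, b) = a • D (1, 0) := by
    intro a b
    have : ((a, b) : ℝ × E) = a • (1, 0) + (0, b) := by simp
    rw [this, map_add, map_smul, hD2, add_zero]
  let q := D (1, 0)
  let e : (ℝ × E) ≃L[ℝ] (ℝ × E) :=
    ContinuousLinearEquiv.equivOfInverse
      ((ContinuousLinearMap.fst ℝ ℝ E).prod (ContinuousLinearMap.snd ℝ ℝ E - (ContinuousLinearMap.fst ℝ ℝ E).smulRight q))
      ((ContinuousLinearMap.fst ℝ ℝ E).prod (ContinuousLinearMap.snd ℝ ℝ E + (ContinuousLinearMap.fst ℝ ℝ E).smulRight q))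
      (fun x => by ext <;> simp) (fun x => by ext <;> simp)
  have hG : HasStrictFDerivAt G (e : (ℝ × E) →L[ℝ] (ℝ × E)) (0, w0) := by
    have h1 : HasStrictFDerivAt G ((ContinuousLinearMap.fst ℝ ℝ E).prod (ContinuousLinearMap.snd ℝ ℝ E - D)) (0, w0) :=
      hasStrictFDerivAt_fst.prodMk (hasStrictFDerivAt_snd.sub hP')
    convert h1 using 1
    refine ContinuousLinearMap.ext fun p => ?_
    obtain ⟨a, b⟩ := p
    change (a, b - a • q) = (a, b - D (a, b))
    rw [hDs]
  have hG0 : G (0, w0) = (0, 0) := by simp [G, h0]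
  let g := hG.localInverse G e (0, w0)
  have hg1 : ∀ᶠ y in nhds ((0, 0) : ℝ × E), G (g y) = y := by
    have := hG.eventually_right_inverse
    rwa [hG0] at this
  have hg2 : Filter.Tendsto g (nhds (0, 0)) (nhds (0, w0)) := by
    have := hG.localInverse_tendsto
    rwa [hG0] at this
  have hι : Filter.Tendsto (fun ε : ℝ => ((ε, 0) : ℝ × E)) (nhds 0) (nhds (0, 0)) :=
    (Continuous.prodMk_left 0).tendsto' _ _ rfl
  refine ⟨fun ε => (g (ε, 0)).2, ?_, ?_⟩
  · exact (continuous_snd.tendsto _).comp (hg2.comp hι)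
  · filter_upwards [hι.eventually hg1] with ε hε
    have h1 := congrArg Prod.fst hε
    have h2 := congrArg Prod.snd hε
    simp only [G] at h1 h2
    have h3 : g (ε, 0) = (ε, (g (ε, 0)).2) := by ext <;> simp [h1]
    rw [← h3]
    exact sub_eq_zero.1 h2

def Fam (α β γ m0 c0 p φ1 φ2 φ3 φ4 χ1 χ2 χ3 χ4 : ℝ) : Prop :=
  ∃ (f f1 f2 f3 f4 : ℝ → ℝ → ℝ) (c ξ1 ξ2 ξ3 ξ4 : ℝ → ℝ),
    (∀ᶠ ε in nhdsWithin (0:ℝ) {0}ᶜ, Chain α β γ (c ε) (f ε) (f1 ε) (f2 ε) (f3 ε) (f4 ε)) ∧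
    (∀ ε, f1 ε p = ε * (φ1 + ε * ξ1 ε)) ∧ (∀ ε, f2 ε p = ε * (φ2 + ε * ξ2 ε)) ∧
    (∀ ε, f3 ε p = ε * (φ3 + ε * ξ3 ε)) ∧ (∀ ε, f4 ε p = ε * (φ4 + ε * ξ4 ε)) ∧
    Filter.Tendsto (fun ε => f ε p) (nhds 0) (nhds m0) ∧
    Filter.Tendsto c (nhds 0) (nhds c0) ∧
    Filter.Tendsto ξ1 (nhds 0) (nhds χ1) ∧ Filter.Tendsto ξ2 (nhds 0) (nhds χ2) ∧
    Filter.Tendsto ξ3 (nhds 0) (nhds χ3) ∧ Filter.Tendsto ξ4 (nhds 0) (nhds χ4)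

lemma Fam.limit {α β γ m0 c0 p φ1 φ2 φ3 φ4 χ1 χ2 χ3 χ4 : ℝ}
    (hF : Fam α β γ m0 c0 p φ1 φ2 φ3 φ4 χ1 χ2 χ3 χ4)
    (Φ : ℝ × ℝ × ℝ × ℝ × ℝ × ℝ × ℝ → ℝ) (hΦ : Continuous Φ)
    (h : ∀ ε, ε ≠ 0 → ∀ (c : ℝ) (f f1 f2 f3 f4 : ℝ → ℝ) (ξ1 ξ2 ξ3 ξ4 : ℝ), Chain α β γ c f f1 f2 f3 f4 →
      f1 p = ε * (φ1 + ε * ξ1) → f2 p = ε * (φ2 + ε * ξ2) → f3 p = ε * (φ3 + ε * ξ3) →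
      f4 p = ε * (φ4 + ε * ξ4) → Φ (ε, f p, c, ξ1, ξ2, ξ3, ξ4) = 0) :
    Φ (0, m0, c0, χ1, χ2, χ3, χ4) = 0 := by
  obtain ⟨f, f1, f2, f3, f4, c, ξ1, ξ2, ξ3, ξ4, hc, h1, h2, h3, h4, t0, t1, t2, t3, t4, t5⟩ := hF
  have ht : Filter.Tendsto (fun ε => Φ (ε, f ε p, c ε, ξ1 ε, ξ2 ε, ξ3 ε, ξ4 ε)) (nhdsWithin (0:ℝ) {0}ᶜ)
      (nhds (Φ (0, m0, c0, χ1, χ2, χ3, χ4))) := by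
    refine (hΦ.tendsto _).comp (Filter.Tendsto.mono_left ?_ nhdsWithin_le_nhds)
    exact Filter.tendsto_id.prodMk_nhds (t0.prodMk_nhds (t1.prodMk_nhds (t2.prodMk_nhds
      (t3.prodMk_nhds (t4.prodMk_nhds t5)))))
  have hz : ∀ᶠ ε in nhdsWithin (0:ℝ) {0}ᶜ, Φ (ε, f ε p, c ε, ξ1 ε, ξ2 ε, ξ3 ε, ξ4 ε) = 0 := by
    filter_upwards [hc, self_mem_nhdsWithin] with ε h5 h6
    exact h ε h6 _ _ _ _ _ _ _ _ _ _ h5 (h1 ε) (h2 ε) (h3 ε) (h4 ε)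
  exact tendsto_nhds_unique (ht.congr' hz) tendsto_const_nhds |>.trans rfl

def Stp (α β γ b0 a1 b2 b3 b4 b5 b6 a6 : ℝ) : Prop :=
  ∀ (c : ℝ) (f f1 f2 f3 f4 : ℝ → ℝ), Chain α β γ c f f1 f2 f3 f4 → ∀ x f5 f7 : ℝ,
    f5 = c * f1 x - α * f x ^ 2 * f1 x - β * f1 x * f2 x - γ * f x * f3 x →
    f7 = c * f3 x - α * (2 * f1 x ^ 3 + 6 * f x * f1 x * f2 x + f x ^ 2 * f3 x)
      - β * (3 * f2 x * f3 x + f1 x * f4 x) - γ * (f2 x * f3 x + 2 * f1 x * f4 x + f x * f5) →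
    b0 * (f x ^ 3 * f1 x) + a1 * f1 x ^ 3 + b2 * (f x * f1 x * f2 x) + b3 * (f x ^ 2 * f3 x)
      + b4 * (f2 x * f3 x) + b5 * (f1 x * f4 x) + b6 * (f x * f5) + a6 * f7 = 0

lemma Fam.order1 {α β γ m0 c0 p φ1 φ2 φ3 φ4 χ1 χ2 χ3 χ4 b0 a1 b2 b3 b4 b5 b6 a6 : ℝ}
    (hF : Fam α β γ m0 c0 p φ1 φ2 φ3 φ4 χ1 χ2 χ3 χ4) (hS : Stp α β γ b0 a1 b2 b3 b4 b5 b6 a6) :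
    b0 * m0 ^ 3 * φ1 + b3 * m0 ^ 2 * φ3 + b6 * m0 * ((c0 - α * m0 ^ 2) * φ1 - γ * m0 * φ3)
      + a6 * ((c0 - α * m0 ^ 2) * φ3 - γ * m0 * ((c0 - α * m0 ^ 2) * φ1 - γ * m0 * φ3)) = 0 := by
  let V5 : ℝ → ℝ → ℝ → ℝ → ℝ → ℝ → ℝ := fun ε f c v1 v2 v3 =>
    c * v1 - α * f ^ 2 * v1 - β * ε * v1 * v2 - γ * f * v3
  have := hF.limit (fun q => (fun ε f c v1 v2 v3 v4 =>
      b0 * (f ^ 3 * v1) + a1 * ε ^ 2 * v1 ^ 3 + b2 * ε * (f * v1 * v2) + b3 * (f ^ 2 * v3)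
      + b4 * ε * (v2 * v3) + b5 * ε * (v1 * v4) + b6 * (f * V5 ε f c v1 v2 v3) +
      a6 * (c * v3 - α * (2 * ε ^ 2 * v1 ^ 3 + 6 * ε * f * v1 * v2 + f ^ 2 * v3)
      - β * ε * (3 * v2 * v3 + v1 * v4) - γ * (ε * v2 * v3 + 2 * ε * v1 * v4 + f * V5 ε f c v1 v2 v3)))
      q.1 q.2.1 q.2.2.1 (φ1 + q.1 * q.2.2.2.1) (φ2 + q.1 * q.2.2.2.2.1) (φ3 + q.1 * q.2.2.2.2.2.1)
      (φ4 + q.1 * q.2.2.2.2.2.2)) (by simp only [V5]; fun_prop) (by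
    intro ε hε c f f1 f2 f3 f4 ξ1 ξ2 ξ3 ξ4 hC h1 h2 h3 h4
    have := hS c f f1 f2 f3 f4 hC p _ _ rfl rfl
    rw [h1, h2, h3, h4] at this
    refine (mul_eq_zero.1 (?_ : ε * _ = 0)).resolve_left hε
    refine Eq.trans ?_ this
    simp only [V5]; ring)
  simp only [V5] at this
  linear_combination this

lemma Fam.order2 {α β γ m0 c0 p φ1 φ2 φ3 φ4 χ1 χ2 χ3 χ4 a1 b2 b4 b5 : ℝ}
    (hF : Fam α β γ m0 c0 p φ1 φ2 φ3 φ4 χ1 χ2 χ3 χ4) (hS : Stp α β γ 0 a1 b2 0 b4 b5 0 0) :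
    b2 * m0 * φ1 * φ2 + b4 * φ2 * φ3 + b5 * φ1 * φ4 = 0 := by
  have := hF.limit (fun q => (fun ε f c v1 v2 v3 v4 =>
      a1 * ε * v1 ^ 3 + b2 * (f * v1 * v2) + b4 * (v2 * v3) + b5 * (v1 * v4))
      q.1 q.2.1 q.2.2.1 (φ1 + q.1 * q.2.2.2.1) (φ2 + q.1 * q.2.2.2.2.1) (φ3 + q.1 * q.2.2.2.2.2.1)
      (φ4 + q.1 * q.2.2.2.2.2.2)) (by fun_prop) (by
    intro ε hε c f f1 f2 f3 f4 ξ1 ξ2 ξ3 ξ4 hC h1 h2 h3 h4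
    have := hS c f f1 f2 f3 f4 hC p _ _ rfl rfl
    rw [h1, h2, h3, h4] at this
    have hε2 : ε ^ 2 ≠ 0 := pow_ne_zero 2 hε
    refine (mul_eq_zero.1 (?_ : ε ^ 2 * _ = 0)).resolve_left hε2
    refine Eq.trans ?_ this
    ring)
  simp only at this
  linear_combination this

lemma Fam.order3 {α β γ m0 c0 p φ1 φ2 φ3 φ4 χ1 χ2 χ3 χ4 a1 b4 : ℝ}
    (hF : Fam α β γ m0 c0 p φ1 φ2 φ3 φ4 χ1 χ2 χ3 χ4) (hS : Stp α β γ 0 a1 0 0 b4 (-b4) 0 0)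
    (h0 : b4 * (φ2 * φ3 - φ1 * φ4) = 0) :
    b4 * (φ2 * χ3 + χ2 * φ3 - φ1 * χ4 - χ1 * φ4) + a1 * φ1 ^ 3 = 0 := by
  have := hF.limit (fun q => (fun ε f c x1 x2 x3 x4 =>
      a1 * (φ1 + ε * x1) ^ 3 + b4 * (φ2 * x3 + x2 * φ3 - φ1 * x4 - x1 * φ4 + ε * (x2 * x3 - x1 * x4)))
      q.1 q.2.1 q.2.2.1 (q.2.2.2.1) (q.2.2.2.2.1) (q.2.2.2.2.2.1)
      (q.2.2.2.2.2.2)) (by fun_prop) (by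
    intro ε hε c f f1 f2 f3 f4 ξ1 ξ2 ξ3 ξ4 hC h1 h2 h3 h4
    have := hS c f f1 f2 f3 f4 hC p _ _ rfl rfl
    rw [h1, h2, h3, h4] at this
    have hε2 : ε ^ 3 ≠ 0 := pow_ne_zero 3 hε
    refine (mul_eq_zero.1 (?_ : ε ^ 3 * _ = 0)).resolve_left hε2
    refine Eq.trans ?_ this
    linear_combination (-ε ^ 2) * h0)
  simp only at this
  linear_combination this

lemma chain_of_first {α β γ c C0 : ℝ} {f f1 f2 f3 f4 : ℝ → ℝ} (h1 : ∀ x, HasDerivAt f (f1 x) x)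
    (h2 : ∀ x, HasDerivAt f1 (f2 x) x) (h3 : ∀ x, HasDerivAt f2 (f3 x) x)
    (h4 : ∀ x, HasDerivAt f3 (f4 x) x)
    (h5 : ∀ x, f4 x = C0 - γ * (f x * f2 x) - (β - γ) / 2 * f1 x ^ 2 - α / 3 * f x ^ 3 + c * f x) :
    Chain α β γ c f f1 f2 f3 f4 := by
  refine ⟨h1, h2, h3, h4, fun x => ?_⟩
  have : f4 = fun x => C0 - γ * (f x * f2 x) - (β - γ) / 2 * f1 x ^ 2 - α / 3 * f x ^ 3 + c * f x := funext h5
  rw [this]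
  refine ((((((h1 x).mul (h3 x)).const_mul γ).const_sub C0).sub (((h2 x).pow 2).const_mul ((β - γ) / 2))).sub
    (((h1 x).pow 3).const_mul (α / 3)) |>.add ((h1 x).const_mul c)).congr_deriv ?_
  simp; ring

noncomputable def sk (k : ℕ) : XX := rs ⟨fun x => Real.sin (k * x), by fun_prop⟩

lemma sk_fold (k : ℕ) (x : ℝ) : sg x * sk k (rr x) = Real.sin (k * x) := (sin_fold k x).symm

lemma case1_fam (α β γ : ℝ) (hγ : γ ≠ 0) (n : ℕ) (hn : 2 ≤ n) (p : ℝ) :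
    ∃ χ1 χ2 χ3 χ4, Fam α β γ ((1 + n ^ 2) / γ) (α * ((1 + n ^ 2) / γ) ^ 2 - n ^ 2) p
      (-Real.sin p - n * Real.sin (n * p)) (-Real.cos p - n ^ 2 * Real.cos (n * p))
      (Real.sin p + n ^ 3 * Real.sin (n * p)) (Real.cos p + n ^ 4 * Real.cos (n * p)) χ1 χ2 χ3 χ4 := by
  obtain ⟨T0, T1, T2, T3, hT⟩ := slv4_trig n hn
  choose ψ ψ1 ψ2 ψ3 d0 d1 d2 d3 e0 e1 e2 e3 using hT
  have hn1 : (n:ℝ)^2 - 1 ≠ 0 := by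
    have : (2:ℝ) ≤ n := by exact_mod_cast hn
    nlinarith
  obtain ⟨m0, hm0⟩ : ∃ m0, m0 = (1 + (n:ℝ) ^ 2) / γ := ⟨_, rfl⟩
  have hm0' : γ * m0 = 1 + (n:ℝ)^2 := by rw [hm0]; field_simp
  rw [← hm0]
  let M1 : XX →L[ℝ] ℝ := (γ * ((n:ℝ)^2 - 1))⁻¹ • (fl 1 - fl n)
  let Kp : XX →L[ℝ] ℝ := fl 1 + γ • M1
  have hKp : ∀ w, Kp w = fl 1 w + γ * M1 w := fun w => by simp [Kp]
  have hM1 : ∀ w, γ * M1 w * ((n:ℝ)^2 - 1) = fl 1 w - fl n w := fun w => by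
    simp [M1]; field_simp
  let φ : XX := ck 1 + ck n
  let φ1 : XX := -sk 1 - (n:ℝ) • sk n
  let φ2 : XX := -ck 1 - ((n:ℝ)^2) • ck n
  let P : ℝ × XX → XX := fun q => -((q.1 * γ * M1 q.2) • T2 q.2 + (q.1 * Kp q.2) • T0 q.2
    + (q.1 * α * M1 q.2 ^ 2) • (φ + q.1 • T0 q.2) + γ • ((φ + q.1 • T0 q.2) * (φ2 + q.1 • T2 q.2))
    + ((β - γ) / 2) • ((φ1 + q.1 • T1 q.2) * (φ1 + q.1 • T1 q.2))
    + (α * (m0 + q.1 * M1 q.2)) • ((φ + q.1 • T0 q.2) * (φ + q.1 • T0 q.2))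
    + (q.1 * α / 3) • ((φ + q.1 • T0 q.2) * (φ + q.1 • T0 q.2) * (φ + q.1 • T0 q.2)))
  obtain ⟨w, hw, hfix⟩ := fixpt P (by simp only [P]; fun_prop)
    (-(γ • (φ * φ2) + ((β - γ) / 2) • (φ1 * φ1) + (α * m0) • (φ * φ))) (by
      intro w; simp [P])
  set w0 := (-(γ • (φ * φ2) + ((β - γ) / 2) • (φ1 * φ1) + (α * m0) • (φ * φ)))
  have hev : ∀ (L : XX →L[ℝ] ℝ), Filter.Tendsto (fun ε => L (w ε)) (nhds 0) (nhds (L w0)) := fun L =>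
    (L.continuous.tendsto _).comp hw
  have hid : Filter.Tendsto (fun ε : ℝ => ε) (nhds 0) (nhds 0) := Filter.tendsto_id
  have hTe : ∀ (T : XX →L[ℝ] XX) (y : Set.Icc (0:ℝ) Real.pi),
      Filter.Tendsto (fun ε => T (w ε) y) (nhds 0) (nhds (T w0 y)) := fun T y =>
    hev ((ContinuousMap.evalCLM ℝ y).comp T)
  let m : ℝ → ℝ := fun ε => m0 + ε * M1 (w ε)
  let c : ℝ → ℝ := fun ε => α * m0 ^ 2 - n ^ 2 + ε * (2 * α * m0 * M1 (w ε) - Kp (w ε))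
  let ψ4 : ℝ → ℝ → ℝ := fun ε x => (w ε - fl 1 (w ε) • ck 1 - fl n (w ε) • ck n) (rr x)
      - (1 + (n:ℝ)^2) * ψ2 (w ε) x - (n:ℝ)^2 * ψ (w ε) x
  have t1 : Filter.Tendsto (fun ε => ψ1 (w ε) p) (nhds 0) (nhds (sg p * T1 w0 (rr p))) := by
    simp only [e1]; exact (hTe T1 (rr p)).const_mul _
  have t2 : Filter.Tendsto (fun ε => ψ2 (w ε) p) (nhds 0) (nhds (T2 w0 (rr p))) := by
    simp only [e2]; exact (hTe T2 (rr p))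
  have t3 : Filter.Tendsto (fun ε => ψ3 (w ε) p) (nhds 0) (nhds (sg p * T3 w0 (rr p))) := by
    simp only [e3]; exact (hTe T3 (rr p)).const_mul _
  have t4 : Filter.Tendsto (fun ε => ψ4 ε p) (nhds 0) (nhds (w0 (rr p) - fl 1 w0 * ck 1 (rr p) - fl n w0 * ck n (rr p)
      - (1 + (n:ℝ)^2) * T2 w0 (rr p) - (n:ℝ)^2 * T0 w0 (rr p))) := by
    simp only [ψ4, e2, e0, ContinuousMap.sub_apply, ContinuousMap.smul_apply, smul_eq_mul]
    exact ((((hTe (ContinuousLinearMap.id ℝ XX) (rr p)).sub ((hev (fl 1)).mul_const _)).sub ((hev (fl n)).mul_const _)).sub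
      ((hTe T2 (rr p)).const_mul _)).sub ((hTe T0 (rr p)).const_mul _)
  refine ⟨_, _, _, _, fun ε x => m ε + ε * (Real.cos x + Real.cos (n * x) + ε * ψ (w ε) x),
    fun ε x => ε * (-Real.sin x - n * Real.sin (n * x) + ε * ψ1 (w ε) x),
    fun ε x => ε * (-Real.cos x - n ^ 2 * Real.cos (n * x) + ε * ψ2 (w ε) x),
    fun ε x => ε * (Real.sin x + n ^ 3 * Real.sin (n * x) + ε * ψ3 (w ε) x),
    fun ε x => ε * (Real.cos x + n ^ 4 * Real.cos (n * x) + ε * ψ4 ε x),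
    c, fun ε => ψ1 (w ε) p, fun ε => ψ2 (w ε) p, fun ε => ψ3 (w ε) p, fun ε => ψ4 ε p, ?_,
    fun ε => rfl, fun ε => rfl, fun ε => rfl, fun ε => rfl, ?_, ?_,
    t1, t2, t3, t4⟩
  · refine Filter.Eventually.filter_mono nhdsWithin_le_nhds ?_
    filter_upwards [hfix] with ε hε
    refine chain_of_first (C0 := α / 3 * m ε ^ 3 - c ε * m ε) ?_ ?_ ?_ ?_ ?_
    · intro x
      refine (((((Real.hasDerivAt_cos x).add (hcos n x)).add ((d0 (w ε) x).const_mul ε)).const_mul ε).const_add _).congr_deriv ?_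
      ring
    · intro x
      refine (((((Real.hasDerivAt_sin x).neg.sub ((hsin n x).const_mul _)).add ((d1 (w ε) x).const_mul ε)).const_mul ε)).congr_deriv ?_
      ring
    · intro x
      refine (((((Real.hasDerivAt_cos x).neg.sub ((hcos n x).const_mul _)).add ((d2 (w ε) x).const_mul ε)).const_mul ε)).congr_deriv ?_
      ring
    · intro x
      refine (((((Real.hasDerivAt_sin x).add ((hsin n x).const_mul _)).add ((d3 (w ε) x).const_mul ε)).const_mul ε)).congr_deriv ?_
      simp only [ψ4]; ring
    · intro x
      have h1 := congrArg (fun z : XX => z (rr x)) hε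
      simp only [P, φ, φ1, φ2, ContinuousMap.neg_apply, ContinuousMap.add_apply, ContinuousMap.smul_apply,
        ContinuousMap.mul_apply, ContinuousMap.sub_apply, smul_eq_mul] at h1
      simp only [ψ4, m, c, ContinuousMap.sub_apply, ContinuousMap.smul_apply, smul_eq_mul]
      have k1 := ck_fold 1 x
      have k2 := sk_fold 1 x
      simp only [Nat.cast_one, one_mul] at k1 k2
      rw [e0, e1, e2, ← k1, ← ck_fold n x, ← k2, ← sk_fold n x]
      have hs := sg_sq x
      have a1 := hM1 (w ε)
      have a2 := hKp (w ε)
      generalize w ε (rr x) = W at *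
      generalize M1 (w ε) = M at *
      generalize Kp (w ε) = Q at *
      generalize fl 1 (w ε) = F1 at *
      generalize fl n (w ε) = Fn at *
      generalize T0 (w ε) (rr x) = t0 at *
      generalize T1 (w ε) (rr x) = t1 at *
      generalize T2 (w ε) (rr x) = t2 at *
      generalize ck 1 (rr x) = y1 at *
      generalize ck n (rr x) = yn at *
      generalize sk 1 (rr x) = z1 at *
      generalize sk n (rr x) = zn at *
      have hFn : Fn = Q - γ * M * (n:ℝ)^2 := by linear_combination a1 - a2
      have hF1 : F1 = Q - γ * M := by linear_combination -a2
      subst hFn hF1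
      linear_combination ε^2 * h1 + ((β - γ)/2 * ε^2 * (-z1 - n * zn + ε * t1)^2) * hs
        + (ε * (-y1 - n^2*yn + ε * t2)) * hm0'
  · simp only [m, e0]
    have h2 : Filter.Tendsto (fun ε : ℝ => m0 + ε * M1 (w ε) + ε * (Real.cos p + Real.cos (n * p) + ε * T0 (w ε) (rr p)))
      (nhds 0) (nhds (m0 + 0 * M1 w0 + 0 * (Real.cos p + Real.cos (n * p) + 0 * T0 w0 (rr p)))) :=
      ((hid.mul (hev M1)).const_add m0).add (hid.mul ((hid.mul (hTe T0 (rr p))).const_add _))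
    simpa using h2
  · have h2 := (hid.mul (((hev M1).const_mul (2 * α * m0)).sub (hev Kp))).const_add (α * m0 ^ 2 - (n:ℝ) ^ 2)
    simpa using h2

lemma case1_alg {α β γ b0 a1 b2 b3 b4 b5 b6 a6 : ℝ} (hγ : γ ≠ 0)
    (hS : Stp α β γ b0 a1 b2 b3 b4 b5 b6 a6) : a1 = 0 ∧ b2 = 0 ∧ b3 = 0 := by
  have hs4 : ∀ j : ℕ, Real.sin (((4 * j : ℕ) : ℝ) * (Real.pi / 2)) = 0 := fun j => by
    have := Real.sin_nat_mul_pi (2 * j)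
    rw [← this]; congr 1; push_cast; ring
  have hc4 : ∀ j : ℕ, Real.cos (((4 * j : ℕ) : ℝ) * (Real.pi / 2)) = 1 := fun j => by
    have := Real.cos_nat_mul_two_pi j
    rw [← this]; congr 1; push_cast; ring
  have o1 : ∀ j : ℕ, 1 ≤ j → -(b0 / γ ^ 3) * (1 + 16 * (j:ℝ) ^ 2) ^ 3 + b3 / γ ^ 2 * (1 + 16 * (j:ℝ) ^ 2) ^ 2
      - b6 / γ * (1 + 16 * (j:ℝ) ^ 2) + a6 = 0 := by
    intro j hj
    obtain ⟨_, _, _, _, hF⟩ := case1_fam α β γ hγ (4 * j) (by omega) (Real.pi / 2)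
    rw [hs4, hc4, Real.sin_pi_div_two, Real.cos_pi_div_two] at hF
    have h := hF.order1 hS
    push_cast at h
    rw [← h]
    field_simp
    ring
  have e1 := o1 1 (by norm_num)
  have e2 := o1 2 (by norm_num)
  have e3 := o1 3 (by norm_num)
  have e4 := o1 4 (by norm_num)
  norm_num at e1 e2 e3 e4
  have B0 : b0 / γ ^ 3 = 0 := by linarith
  have B3 : b3 / γ ^ 2 = 0 := by linarith
  have B6 : b6 / γ = 0 := by linarith
  have A6 : a6 = 0 := by linarith
  have B0' : b0 = 0 := by simpa [hγ] using B0
  have B3' : b3 = 0 := by simpa [hγ] using B3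
  have B6' : b6 = 0 := by simpa [hγ] using B6
  subst A6 B0' B3' B6'
  have o2 : ∀ j : ℕ, 1 ≤ j → b2 / γ * (1 + 16 * (j:ℝ) ^ 2) = b4 + b5 * (16 * (j:ℝ) ^ 2) := by
    intro j hj
    obtain ⟨_, _, _, _, hF⟩ := case1_fam α β γ hγ (4 * j) (by omega) (Real.pi / 2)
    rw [hs4, hc4, Real.sin_pi_div_two, Real.cos_pi_div_two] at hF
    have h := hF.order2 hS
    push_cast at h
    have hj' : (j:ℝ) ≠ 0 := by positivity
    have h16 : 16 * (j:ℝ)^2 ≠ 0 := by positivity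
    have h' : 16 * (j:ℝ)^2 * (b2 / γ * (1 + 16 * (j:ℝ) ^ 2) - (b4 + b5 * (16 * (j:ℝ) ^ 2))) = 0 := by
      linear_combination h
    have := (mul_eq_zero.1 h').resolve_left h16
    linarith
  have e5 := o2 1 (by norm_num)
  have e6 := o2 2 (by norm_num)
  norm_num at e5 e6
  have B5 : b5 = b2 / γ := by linarith
  have B4 : b4 = b2 / γ := by linarith
  obtain ⟨_, _, _, _, hF⟩ := case1_fam α β γ hγ 4 (by norm_num) (Real.pi / 4)
  rw [show ((4:ℕ):ℝ) * (Real.pi / 4) = Real.pi by push_cast; ring, Real.sin_pi, Real.cos_pi,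
    Real.sin_pi_div_four, Real.cos_pi_div_four] at hF
  have h := hF.order2 hS
  rw [B5, B4] at h
  have h2 : b2 / γ * 15 * (√2 / 2) ^ 2 = 0 := by
    rw [← h]; push_cast; field_simp; ring
  have h3 : b2 / γ = 0 := by
    have : (√2 / 2) ^ 2 = 1 / 2 := by rw [div_pow, Real.sq_sqrt (by norm_num)]; norm_num
    rw [this] at h2; linarith
  have B2 : b2 = 0 := by simpa [hγ] using h3
  rw [B2, zero_div] at B4 B5
  subst B2 B4 B5
  have hS' : Stp α β γ 0 a1 0 0 0 (-0) 0 0 := by simpa using hS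
  obtain ⟨_, _, _, _, hF⟩ := case1_fam α β γ hγ (4 * 1) (by norm_num) (Real.pi / 2)
  rw [hs4, hc4, Real.sin_pi_div_two, Real.cos_pi_div_two] at hF
  have h := hF.order3 hS' (by ring)
  refine ⟨?_, rfl, rfl⟩
  linarith

lemma case2_fam (α β : ℝ) (m p : ℝ) :
    Fam α β 0 m (1 + α * m ^ 2) p (-Real.sin p) (-Real.cos p) (Real.sin p) (Real.cos p)
      (-2 * ((β - 2 * α * m) / 60) * Real.sin (2 * p)) (-4 * ((β - 2 * α * m) / 60) * Real.cos (2 * p))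
      (8 * ((β - 2 * α * m) / 60) * Real.sin (2 * p)) (16 * ((β - 2 * α * m) / 60) * Real.cos (2 * p)) := by
  obtain ⟨T0, T1, T2, T3, hT⟩ := slv4_hyp
  choose ψ ψ1 ψ2 ψ3 d0 d1 d2 d3 e0 e1 e2 e3 using hT
  obtain ⟨A2, hA2⟩ : ∃ A2, A2 = (β - 2 * α * m) / 60 := ⟨_, rfl⟩
  obtain ⟨A0, hA0⟩ : ∃ A0, A0 = β / 4 + α * m / 2 := ⟨_, rfl⟩
  rw [← hA2]
  let φ : XX := ck 1
  let φ1 : XX := -sk 1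
  let χ : XX := A0 • 1 + A2 • ck 2
  let χ1 : XX := (-2 * A2) • sk 2
  let P : ℝ × XX → XX := fun q => (-fl 1 q.2) • (q.1 • χ + (q.1 ^ 2) • T0 q.2)
    - (β / 2) • ((χ1 + q.1 • T1 q.2) * (φ1 + q.1 • χ1 + (q.1 ^ 2) • T1 q.2 + φ1))
    - (α * m) • ((χ + q.1 • T0 q.2) * (φ + q.1 • χ + (q.1 ^ 2) • T0 q.2 + φ))
    - (α / 3) • ((φ + q.1 • χ + (q.1 ^ 2) • T0 q.2) * (φ + q.1 • χ + (q.1 ^ 2) • T0 q.2) * (φ + q.1 • χ + (q.1 ^ 2) • T0 q.2))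
  obtain ⟨w, hw, hfix⟩ := fixpt P (by simp only [P]; fun_prop)
    (-((β / 2) • (χ1 * (φ1 + φ1))) - (α * m) • (χ * (φ + φ)) - (α / 3) • (φ * φ * φ)) (by
      intro w; simp [P])
  set w0 := (-((β / 2) • (χ1 * (φ1 + φ1))) - (α * m) • (χ * (φ + φ)) - (α / 3) • (φ * φ * φ))
  have hev : ∀ (L : XX →L[ℝ] ℝ), Filter.Tendsto (fun ε => L (w ε)) (nhds 0) (nhds (L w0)) := fun L =>
    (L.continuous.tendsto _).comp hw
  have hid : Filter.Tendsto (fun ε : ℝ => ε) (nhds 0) (nhds 0) := Filter.tendsto_id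
  have hTe : ∀ (T : XX →L[ℝ] XX) (y : Set.Icc (0:ℝ) Real.pi),
      Filter.Tendsto (fun ε => T (w ε) y) (nhds 0) (nhds (T w0 y)) := fun T y =>
    hev ((ContinuousMap.evalCLM ℝ y).comp T)
  let c : ℝ → ℝ := fun ε => 1 + α * m ^ 2 + ε ^ 2 * (-fl 1 (w ε))
  let ψ4 : ℝ → ℝ → ℝ := fun ε x => (w ε - fl 1 (w ε) • ck 1) (rr x)
      - (1 + (-1)) * ψ2 (w ε) x - (-1) * ψ (w ε) x
  have hlim : ∀ (g : ℝ → ℝ) (y z : ℝ), Filter.Tendsto g (nhds 0) (nhds y) →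
      Filter.Tendsto (fun ε => z + ε * g ε) (nhds 0) (nhds z) := by
    intro g y z hg
    simpa using (hid.mul hg).const_add z
  have t1 : Filter.Tendsto (fun ε => ψ1 (w ε) p) (nhds 0) (nhds (sg p * T1 w0 (rr p))) := by
    simp only [e1]; exact (hTe T1 (rr p)).const_mul _
  have t2 : Filter.Tendsto (fun ε => ψ2 (w ε) p) (nhds 0) (nhds (T2 w0 (rr p))) := by
    simp only [e2]; exact (hTe T2 (rr p))
  have t3 : Filter.Tendsto (fun ε => ψ3 (w ε) p) (nhds 0) (nhds (sg p * T3 w0 (rr p))) := by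
    simp only [e3]; exact (hTe T3 (rr p)).const_mul _
  have t4 : Filter.Tendsto (fun ε => ψ4 ε p) (nhds 0) (nhds (w0 (rr p) - fl 1 w0 * ck 1 (rr p)
      - (1 + (-1)) * T2 w0 (rr p) - (-1) * T0 w0 (rr p))) := by
    simp only [ψ4, e2, e0, ContinuousMap.sub_apply, ContinuousMap.smul_apply, smul_eq_mul]
    exact (((hTe (ContinuousLinearMap.id ℝ XX) (rr p)).sub ((hev (fl 1)).mul_const _)).sub
      ((hTe T2 (rr p)).const_mul _)).sub ((hTe T0 (rr p)).const_mul _)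
  refine ⟨fun ε x => m + ε * (Real.cos x + ε * (A0 + A2 * Real.cos (2 * x) + ε * ψ (w ε) x)),
    fun ε x => ε * (-Real.sin x + ε * (-2 * A2 * Real.sin (2 * x) + ε * ψ1 (w ε) x)),
    fun ε x => ε * (-Real.cos x + ε * (-4 * A2 * Real.cos (2 * x) + ε * ψ2 (w ε) x)),
    fun ε x => ε * (Real.sin x + ε * (8 * A2 * Real.sin (2 * x) + ε * ψ3 (w ε) x)),
    fun ε x => ε * (Real.cos x + ε * (16 * A2 * Real.cos (2 * x) + ε * ψ4 ε x)),
    c, fun ε => -2 * A2 * Real.sin (2 * p) + ε * ψ1 (w ε) p, fun ε => -4 * A2 * Real.cos (2 * p) + ε * ψ2 (w ε) p,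
    fun ε => 8 * A2 * Real.sin (2 * p) + ε * ψ3 (w ε) p, fun ε => 16 * A2 * Real.cos (2 * p) + ε * ψ4 ε p, ?_,
    fun ε => rfl, fun ε => rfl, fun ε => rfl, fun ε => rfl, ?_, ?_,
    hlim _ _ _ t1, hlim _ _ _ t2, hlim _ _ _ t3, hlim _ _ _ t4⟩
  · refine Filter.Eventually.filter_mono nhdsWithin_le_nhds ?_
    filter_upwards [hfix] with ε hε
    refine chain_of_first (C0 := α / 3 * m ^ 3 - c ε * m + ε ^ 2 * (α * m / 2 + β / 4 - A0)) ?_ ?_ ?_ ?_ ?_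
    · intro x
      refine ((((Real.hasDerivAt_cos x).add (((((hcos 2 x).const_mul A2).const_add A0).add
        ((d0 (w ε) x).const_mul ε)).const_mul ε)).const_mul ε).const_add _).congr_deriv ?_
      ring
    · intro x
      refine ((((Real.hasDerivAt_sin x).neg.add (((((hsin 2 x).const_mul _)).add
        ((d1 (w ε) x).const_mul ε)).const_mul ε)).const_mul ε)).congr_deriv ?_
      ring
    · intro x
      refine ((((Real.hasDerivAt_cos x).neg.add (((((hcos 2 x).const_mul _)).add
        ((d2 (w ε) x).const_mul ε)).const_mul ε)).const_mul ε)).congr_deriv ?_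
      ring
    · intro x
      refine ((((Real.hasDerivAt_sin x).add (((((hsin 2 x).const_mul _)).add
        ((d3 (w ε) x).const_mul ε)).const_mul ε)).const_mul ε)).congr_deriv ?_
      simp only [ψ4]; ring
    · intro x
      have h1 := congrArg (fun z : XX => z (rr x)) hε
      simp only [P, φ, φ1, χ, χ1, ContinuousMap.neg_apply, ContinuousMap.add_apply, ContinuousMap.smul_apply,
        ContinuousMap.mul_apply, ContinuousMap.sub_apply, ContinuousMap.one_apply, smul_eq_mul] at h1
      simp only [ψ4, c, ContinuousMap.sub_apply, ContinuousMap.smul_apply, smul_eq_mul]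
      have k1 := ck_fold 1 x
      have k2 := sk_fold 1 x
      have k3 := ck_fold 2 x
      have k4 := sk_fold 2 x
      simp only [Nat.cast_one, Nat.cast_ofNat, one_mul] at k1 k2 k3 k4
      have q1 := Real.cos_sq_add_sin_sq x
      have q2 := Real.cos_two_mul x
      rw [← k1, ← k2] at q1
      rw [← k3, ← k1] at q2
      rw [e0, e1, e2, ← k1, ← k2, ← k3, ← k4]
      have hs := sg_sq x
      generalize w ε (rr x) = W at *
      generalize fl 1 (w ε) = F1 at *
      generalize T0 (w ε) (rr x) = s0 at *
      generalize T1 (w ε) (rr x) = s1 at *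
      generalize T2 (w ε) (rr x) = s2 at *
      generalize ck 1 (rr x) = y1 at *
      generalize ck 2 (rr x) = y2 at *
      generalize sk 1 (rr x) = z1 at *
      generalize sk 2 (rr x) = z2 at *
      have q3 : z1 ^ 2 = 1 - y1 ^ 2 := by linear_combination q1 - z1 ^ 2 * hs
      subst hA2 hA0
      linear_combination ε^3 * h1 + (β / 2 * ε^2 * (-z1 + ε * (-2 * ((β - 2 * α * m) / 60) * z2 + ε * s1))^2) * hs
        + (β/2 * ε^2) * q3 + (ε^2 * (15 * ((β - 2 * α * m) / 60))) * q2
  · simp only [e0]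
    have h2 := hlim (fun ε => Real.cos p + ε * (A0 + A2 * Real.cos (2 * p) + ε * T0 (w ε) (rr p))) _ m
      (hlim _ _ _ (hlim _ _ _ (hTe T0 (rr p))))
    simpa using h2
  · have h2 := hlim (fun ε => ε * (-fl 1 (w ε))) _ (1 + α * m ^ 2)
      (hid.mul (hev (fl 1)).neg)
    refine h2.congr fun ε => ?_
    simp only [c]; ring

lemma case2_alg {α β b0 a1 b2 b3 b4 b5 b6 a6 : ℝ} (hα : α ≠ 0)
    (hS : Stp α β 0 b0 a1 b2 b3 b4 b5 b6 a6) : a1 = 0 ∧ b2 = 0 ∧ b3 = 0 := by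
  have o1 : ∀ m : ℝ, -b0 * m ^ 3 + b3 * m ^ 2 - b6 * m + a6 = 0 := by
    intro m
    have h := (case2_fam α β m (Real.pi / 2)).order1 hS
    rw [Real.sin_pi_div_two] at h
    linear_combination h
  have e1 := o1 0
  have e2 := o1 1
  have e3 := o1 (-1)
  have e4 := o1 2
  norm_num at e1 e2 e3 e4
  have B0 : b0 = 0 := by linarith
  have B3 : b3 = 0 := by linarith
  have B6 : b6 = 0 := by linarith
  subst e1 B0 B3 B6
  have o2 : ∀ m : ℝ, b2 * m - b4 - b5 = 0 := by
    intro m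
    have h := (case2_fam α β m (Real.pi / 4)).order2 hS
    rw [Real.sin_pi_div_four, Real.cos_pi_div_four] at h
    have : (√2 / 2) ^ 2 = 1 / 2 := by rw [div_pow, Real.sq_sqrt (by norm_num)]; norm_num
    linear_combination 2 * h - 2 * (b2 * m - b4 - b5) * this
  have e5 := o2 0
  have e6 := o2 1
  have B2 : b2 = 0 := by linarith
  have B5 : b5 = -b4 := by linarith
  subst B2 B5
  have o3 : ∀ m : ℝ, b4 * (-12 * ((β - 2 * α * m) / 60)) - a1 = 0 := by
    intro m
    have h := (case2_fam α β m (Real.pi / 2)).order3 hS (by ring)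
    rw [Real.sin_pi_div_two, Real.cos_pi_div_two, show 2 * (Real.pi / 2) = Real.pi by ring,
      Real.sin_pi, Real.cos_pi] at h
    linear_combination h
  have e7 := o3 0
  have e8 := o3 1
  have B4 : b4 * α = 0 := by linarith
  have B4' : b4 = 0 := (mul_eq_zero.1 B4).resolve_right hα
  subst B4'
  refine ⟨?_, rfl, rfl⟩
  linarith

lemma case3_alg {β b0 a1 b2 b3 b4 b5 b6 a6 : ℝ} (hβ : β ≠ 0)
    (hS : Stp 0 β 0 b0 a1 b2 b3 b4 b5 b6 a6) : a1 = 0 ∧ b2 = 0 ∧ b3 = 0 := by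
  have o1 : ∀ F : ℝ, b0 * F ^ 3 + a1 + b2 * F = 0 := by
    intro F
    have h := hS β (fun x => (F - 1 / 2) + x ^ 2 / 2) (fun x => x) (fun _ => 1) (fun _ => 0) (fun _ => 0)
      ⟨fun x => (((hasDerivAt_pow 2 x).div_const 2).const_add _).congr_deriv (by norm_num),
        fun x => hasDerivAt_id x, fun x => hasDerivAt_const _ _, fun x => hasDerivAt_const _ _,
        fun x => (hasDerivAt_const _ _).congr_deriv (by ring)⟩ 1 _ _ rfl rfl
    linear_combination h
  have e1 := o1 0
  have e2 := o1 1
  have e3 := o1 2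
  norm_num at e1 e2 e3
  have B0 : b0 = 0 := by linarith
  have B2 : b2 = 0 := by linarith
  subst e1 B0 B2
  refine ⟨rfl, rfl, ?_⟩
  let T : ℝ → ℝ := fun x => Real.sinh x / Real.cosh x
  have hT : ∀ x, HasDerivAt T (1 - T x ^ 2) x := by
    intro x
    have hc : Real.cosh x ≠ 0 := (Real.cosh_pos x).ne'
    refine ((Real.hasDerivAt_sinh x).div (Real.hasDerivAt_cosh x) hc).congr_deriv ?_
    simp only [T]; field_simp
  obtain ⟨K, hK⟩ : ∃ K, K = 60 / β := ⟨_, rfl⟩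
  have hK' : β * K = 60 := by rw [hK]; field_simp
  have hK0 : K ≠ 0 := by rintro rfl; norm_num at hK'
  have hpw : ∀ (n : ℕ) x, HasDerivAt (fun x => T x ^ n) (n * T x ^ (n - 1) * (1 - T x ^ 2)) x :=
    fun n x => (hT x).pow n
  have hC : ∀ B : ℝ, Chain 0 β 0 16 (fun x => B + K * (1 - T x ^ 2)) (fun x => K * (-2 * T x + 2 * T x ^ 3))
      (fun x => K * (-2 + 8 * T x ^ 2 - 6 * T x ^ 4)) (fun x => K * (16 * T x - 40 * T x ^ 3 + 24 * T x ^ 5))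
      (fun x => K * (16 - 136 * T x ^ 2 + 240 * T x ^ 4 - 120 * T x ^ 6)) := by
    intro B
    refine ⟨fun x => ?_, fun x => ?_, fun x => ?_, fun x => ?_, fun x => ?_⟩
    · refine ((((hpw 2 x).const_sub 1).const_mul K).const_add B).congr_deriv ?_
      push_cast; ring
    · refine ((((hT x).const_mul (-2)).add ((hpw 3 x).const_mul 2)).const_mul K).congr_deriv ?_
      push_cast; ring
    · refine (((((hpw 2 x).const_mul 8).const_add (-2)).sub ((hpw 4 x).const_mul 6)).const_mul K).congr_deriv ?_
      push_cast; ring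
    · refine (((((hT x).const_mul 16).sub ((hpw 3 x).const_mul 40)).add ((hpw 5 x).const_mul 24)).const_mul K).congr_deriv ?_
      push_cast; ring
    · refine ((((((hpw 2 x).const_mul 136).const_sub 16).add ((hpw 4 x).const_mul 240)).sub
        ((hpw 6 x).const_mul 120)).const_mul K).congr_deriv ?_
      push_cast
      generalize T x = y
      linear_combination (K * (-2 * y + 2 * y ^ 3) * (-2 + 8 * y ^ 2 - 6 * y ^ 4)) * hK'
  have k : ∀ B x : ℝ, _ := fun B x => hS 16 _ _ _ _ _ (hC B) x _ _ rfl rfl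
  have key : ∀ x, b3 * (K * (16 * T x - 40 * T x ^ 3 + 24 * T x ^ 5)) = 0 := by
    intro x
    linear_combination (k 1 x + k (-1) x - 2 * k 0 x) / 2
  have hd := ((hC 0).2.2.2.1 0).const_mul b3
  have hz : HasDerivAt (fun x => b3 * (K * (16 * T x - 40 * T x ^ 3 + 24 * T x ^ 5))) 0 0 := by
    rw [funext key]; exact hasDerivAt_const _ _
  have h0 : T 0 = 0 := by simp [T]
  have := hd.unique hz
  beta_reduce at this
  rw [h0] at this
  have h2 : b3 * (K * 16) = 0 := by linear_combination this
  simpa [hK0] using h2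

lemma stp_of {α β γ : ℝ} {N : ℕ} {J : MvPolynomial (Fin N) ℝ} (hJ : Conserved α β γ N J) :
    ∃ a0 a1 a2 a3 a4 a5 a6 : ℝ, Stp α β γ (4 * a0 - 2 * α) a1 (2 * a1 + 2 * a2 - 2 * β) (a2 - 2 * γ)
      (2 * a3 + a4) (a4 + a5) (a5 - 2) a6 := by
  obtain ⟨a0, a1, a2, a3, a4, a5, a6, h⟩ := star hJ
  refine ⟨a0, a1, a2, a3, a4, a5, a6, ?_⟩
  intro c f f1 f2 f3 f4 hC x f5 f7 h5 h7
  subst h5 h7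
  exact h c f f1 f2 f3 f4 _ _ _ hC (fun x => rfl) (fun x => rfl) (fun x => rfl) x

lemma fwd {α β γ : ℝ} {N : ℕ} {J : MvPolynomial (Fin N) ℝ} (hJ : Conserved α β γ N J) : β = 2 * γ := by
  obtain ⟨a0, a1, a2, a3, a4, a5, a6, hS⟩ := stp_of hJ
  have fin : ∀ h : a1 = 0 ∧ 2 * a1 + 2 * a2 - 2 * β = 0 ∧ a2 - 2 * γ = 0, β = 2 * γ := by
    rintro ⟨h1, h2, h3⟩
    linarith
  by_cases hγ : γ = 0
  · subst hγ
    by_cases hα : α = 0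
    · subst hα
      by_cases hβ : β = 0
      · subst hβ; norm_num
      · exact fin (case3_alg hβ hS)
    · exact fin (case2_alg hα hS)
  · exact fin (case1_alg hγ hS)

theorem fifth_order_kdv_u_sq_conserved_iff (α β γ : ℝ) :
    (∃ (N : ℕ) (J : MvPolynomial (Fin N) ℝ),
      ∀ u : ℝ × ℝ → ℝ, ContDiff ℝ (⊤ : ℕ∞) u →
        (∀ p : ℝ × ℝ,
          pdt u p + α * (u p) ^ 2 * pdx u p + β * pdx u p * pdx (pdx u) p
            + γ * u p * pdx (pdx (pdx u)) p + pdx (pdx (pdx (pdx (pdx u)))) p = 0) →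
        ∀ p : ℝ × ℝ, pdt (fun q => (u q) ^ 2) p + pdx (evalJet N J u) p = 0) ↔
    β = 2 * γ := by
  constructor
  · rintro ⟨N, J, h⟩
    exact fwd (N := N) (J := J) h
  · intro h
    exact backward_s14 α β γ h
end
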